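/- Let α ≥ 0 be a real number. For all integers n ≥ N(2,α), the sequence r_α is strictly log-convex at n, i.e., r_α(n+1)² < r_α(n)·r_α(n+2). -/

import Mathlib

open Real

/-- The overpartition function. -/
noncomputable def pbar (n : ℕ) : ℕ :=
  ∑ k ∈ Finset.range (n + 1),
    (Nat.Partition.distincts k).card * Fintype.card (Nat.Partition (n - k))

/-- `r_α(n) = (p̄(n)/n^α)^(1/n)`. -/
noncomputable def rseq (α : ℝ) (n : ℕ) : ℝ :=
  ((pbar n : ℝ) / (n : ℝ) ^ α) ^ ((n : ℝ)⁻¹)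

/-- Forward difference operator. -/
noncomputable def fdiff (f : ℕ → ℝ) : ℕ → ℝ := fun n => f (n + 1) - f n

/-- `C(r) = π (1/2)_r`. -/
noncomputable def Cr (r : ℕ) : ℝ := π * (ascPochhammer ℝ r).eval (1/2 : ℝ)

/-- `C(r,α) = (α+1) r! + (r−1)! log 8 + 1`. -/
noncomputable def Crα (r : ℕ) (α : ℝ) : ℝ :=
  (α + 1) * (Nat.factorial r) + (Nat.factorial (r - 1)) * Real.log 8 + 1

/-- `S_0 = 0`, `S_n = n S_{n−1} + (n−1)!`. -/
noncomputable def Sseq : ℕ → ℝ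
  | 0 => 0
  | n + 1 => (n + 1) * Sseq n + (Nat.factorial n)

noncomputable def N₀ (m : ℕ) : ℝ :=
  if m = 1 then 1 else 2 * m * Real.log m - m * Real.log (Real.log m)

noncomputable def N₁ (r : ℕ) : ℝ :=
  max (85 : ℝ) ((⌈(4 / π ^ 2) * (N₀ (2 * r + 2)) ^ 2⌉ : ℤ) : ℝ)

noncomputable def C₂ (r : ℕ) : ℝ :=
  (∑ k ∈ Finset.range (2 * r - 1),
    (1 / (((k : ℝ) + 1) ^ 2 * π ^ (k + 1))) *
      (ascPochhammer ℝ r).eval (((k : ℝ) + 1) / 2) * (1 / (r : ℝ) ^ k))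
  + 2 * r / 10 ^ r

noncomputable def N₂ (r : ℕ) : ℝ :=
  max ((⌈2 * (Cr r) ^ 2⌉ : ℤ) : ℝ)
    ((⌈((2 : ℝ) ^ (r + 1) / ((Nat.factorial (r - 1)) * Real.log 8)) ^ 2⌉ : ℤ) : ℝ)

noncomputable def N₃ (r : ℕ) (α : ℝ) : ℝ :=
  max (max (5505 : ℝ) (4 * (r : ℝ) ^ 2))
    (max ((⌈(4 * (r : ℝ) ^ 2 * Cr r + C₂ r) ^ ((4 : ℝ) / 3)⌉ : ℤ) : ℝ)
         ((⌈(Crα r α / Cr r) ^ 4⌉ : ℤ) : ℝ))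

noncomputable def Ncut (r : ℕ) (α : ℝ) : ℝ :=
  max (max (N₁ r) ((⌈Real.exp (Sseq r / (Nat.factorial r))⌉ : ℤ) : ℝ))
      (max (N₂ r) (N₃ r α))

open Filter Topology

/-- The Euler product `∏ (1 - z ^ m)`. -/
noncomputable def eulerProd (z : ℂ) : ℂ := ∏' i : ℕ, (1 - z ^ (i + 1))

/-- The generating function of overpartitions, as a quotient of Euler products. -/
noncomputable def overGen (z : ℂ) : ℂ := eulerProd (z ^ 2) / eulerProd z ^ 2

section PowerSeriesEvaluation

open PowerSeries

/-- A real power series converges absolutely to `v` at `z`. -/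
def AbsEval (f : ℝ⟦X⟧) (z v : ℂ) : Prop :=
  Summable (fun n ↦ ‖((coeff n f : ℝ) : ℂ) * z ^ n‖) ∧ HasSum (fun n ↦ ((coeff n f : ℝ) : ℂ) * z ^ n) v

theorem AbsEval.mul {f g : ℝ⟦X⟧} {z v w : ℂ} (hf : AbsEval f z v) (hg : AbsEval g z w) :
    AbsEval (f * g) z (v * w) := by
  have key : (fun n ↦ ((coeff n (f * g) : ℝ) : ℂ) * z ^ n) = fun n ↦
      ∑ kl ∈ Finset.HasAntidiagonal.antidiagonal n,
        (((coeff kl.1 f : ℝ) : ℂ) * z ^ kl.1) * (((coeff kl.2 g : ℝ) : ℂ) * z ^ kl.2) := by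
    funext n
    rw [coeff_mul]
    push_cast
    rw [Finset.sum_mul]
    refine Finset.sum_congr rfl fun kl hkl ↦ ?_
    rw [← Finset.HasAntidiagonal.mem_antidiagonal.mp hkl, pow_add]
    ring
  have hs := summable_norm_sum_mul_antidiagonal_of_summable_norm hf.1 hg.1
  refine ⟨?_, ?_⟩
  · simpa only [funext_iff.mp key] using hs
  · rw [key, ← hf.2.tsum_eq, ← hg.2.tsum_eq,
      tsum_mul_tsum_eq_tsum_sum_antidiagonal_of_summable_norm hf.1 hg.1]
    exact hs.of_norm.hasSum

theorem absEval_one (z : ℂ) : AbsEval 1 z 1 := by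
  have h : HasSum (fun n ↦ ((coeff n (1 : ℝ⟦X⟧) : ℝ) : ℂ) * z ^ n) 1 := by
    convert hasSum_single 0 ?_ using 1
    · simp
    · intro n hn
      simp [coeff_one, hn]
  refine ⟨?_, h⟩
  refine summable_of_ne_finset_zero (s := {0}) fun n hn ↦ ?_
  simp only [Finset.mem_singleton] at hn
  simp [coeff_one, hn]

theorem absEval_one_add_X_pow {m : ℕ} (hm : m ≠ 0) (z : ℂ) :
    AbsEval (1 + X ^ m) z (1 + z ^ m) := by
  have h0 : ∀ n ∉ ({0, m} : Finset ℕ), coeff n (1 + X ^ m : ℝ⟦X⟧) = 0 := by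
    intro n hn
    simp only [Finset.mem_insert, Finset.mem_singleton, not_or] at hn
    simp [coeff_one, coeff_X_pow, hn.1, hn.2]
  refine ⟨summable_of_ne_finset_zero (s := {0, m}) fun n hn ↦ by simp [h0 n hn], ?_⟩
  have h := hasSum_sum_of_ne_finset_zero (s := ({0, m} : Finset ℕ))
    (f := fun n ↦ ((coeff n (1 + X ^ m : ℝ⟦X⟧) : ℝ) : ℂ) * z ^ n)
    (L := SummationFilter.unconditional ℕ) (fun n hn ↦ by simp [h0 n hn])
  rw [Finset.sum_pair hm.symm] at h
  simpa [coeff_one, coeff_X_pow, hm, hm.symm] using h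

/-- The geometric series `∑ X ^ (m * j)`. -/
noncomputable def geomSeries (m : ℕ) : ℝ⟦X⟧ := PowerSeries.mk fun n ↦ if m ∣ n then 1 else 0

theorem absEval_geomSeries {m : ℕ} (hm : m ≠ 0) {z : ℂ} (hz : ‖z‖ < 1) :
    AbsEval (geomSeries m) z ((1 - z ^ m)⁻¹) := by
  have hzm : ‖z ^ m‖ < 1 := by
    rw [norm_pow]; exact pow_lt_one₀ (norm_nonneg _) hz hm
  have hinj : Function.Injective fun j : ℕ ↦ m * j :=
    fun a b h ↦ Nat.eq_of_mul_eq_mul_left (Nat.pos_of_ne_zero hm) h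
  have h0 : ∀ n ∉ Set.range (fun j : ℕ ↦ m * j),
      ((coeff n (geomSeries m) : ℝ) : ℂ) * z ^ n = 0 := by
    intro n hn
    have : ¬ m ∣ n := fun ⟨k, hk⟩ ↦ hn ⟨k, hk.symm⟩
    simp [geomSeries, this]
  refine ⟨?_, ?_⟩
  · refine (hinj.summable_iff (fun n hn ↦ by rw [h0 n hn, norm_zero])).mp ?_
    convert summable_geometric_of_lt_one (norm_nonneg _) hzm using 1
    funext j
    simp [geomSeries, pow_mul]
  · refine (hinj.hasSum_iff h0).mp ?_
    have e : ((fun n ↦ ((coeff n (geomSeries m) : ℝ) : ℂ) * z ^ n) ∘ fun j ↦ m * j) =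
        fun j ↦ (z ^ m) ^ j := by
      funext j
      simp [geomSeries, pow_mul]
    rw [e]
    exact hasSum_geometric_of_norm_lt_one hzm

open PowerSeries.WithPiTopology in
theorem tsum_X_pow_mul {m : ℕ} (hm : m ≠ 0) :
    ∑' j : ℕ, (X ^ (m * j) : ℝ⟦X⟧) = geomSeries m := by
  refine HasSum.tsum_eq ?_
  rw [hasSum_iff_hasSum_coeff]
  intro n
  by_cases h : m ∣ n
  · obtain ⟨k, rfl⟩ := h
    convert hasSum_single k ?_ using 1
    · simp [geomSeries, coeff_X_pow]
    · intro j hj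
      simp [coeff_X_pow, hm, Ne.symm hj]
  · have : ∀ j, coeff n (X ^ (m * j) : ℝ⟦X⟧) = 0 := by
      intro j
      rw [coeff_X_pow, if_neg]
      exact fun hn ↦ h ⟨j, hn⟩
    simp [geomSeries, h, this, hasSum_zero]

/-- The finite products approximating the generating function of overpartitions. -/
noncomputable def partialOver (N : ℕ) : ℝ⟦X⟧ :=
  ∏ i ∈ Finset.range N, ((1 + X ^ (i + 1)) * geomSeries (i + 1))

theorem coeff_mk_mul_mk_eq_pbar (n : ℕ) :
    coeff n ((PowerSeries.mk fun n ↦ ((Nat.Partition.distincts n).card : ℝ)) *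
      PowerSeries.mk fun n ↦ ((Fintype.card (Nat.Partition n) : ℕ) : ℝ)) = pbar n := by
  rw [coeff_mul, Finset.Nat.sum_antidiagonal_eq_sum_range_succ_mk, pbar]
  push_cast
  simp

open PowerSeries.WithPiTopology in
theorem tendsto_coeff_partialOver (n : ℕ) :
    Tendsto (fun N ↦ coeff n (partialOver N)) atTop (𝓝 (pbar n : ℝ)) := by
  have h1 := Nat.Partition.hasProd_powerSeriesMk_card_countRestricted ℝ (m := 2) (by norm_num)
  have h2 := Nat.Partition.hasProd_powerSeriesMk_card_restricted ℝ (fun _ ↦ True)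
  have h := (h1.mul h2).tendsto_prod_nat
  rw [tendsto_iff_coeff_tendsto] at h
  have := h n
  convert this using 2 with N
  · congr 1
    refine Finset.prod_congr rfl fun i _ ↦ ?_
    rw [← tsum_X_pow_mul (Nat.succ_ne_zero i)]
    simp [Finset.sum_range_succ]
  · rw [← coeff_mk_mul_mk_eq_pbar]
    simp [Nat.Partition.countRestricted_two, Nat.Partition.restricted]

theorem coeff_partialOver_nonneg (N n : ℕ) : 0 ≤ coeff n (partialOver N) := by
  induction N generalizing n with
  | zero => simp only [partialOver, Finset.range_zero, Finset.prod_empty, coeff_one]; split_ifs <;> simp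
  | succ N ih =>
    have h1 : ∀ k, 0 ≤ coeff k ((1 + X ^ (N + 1)) * geomSeries (N + 1) : ℝ⟦X⟧) := by
      intro k
      rw [coeff_mul]
      refine Finset.sum_nonneg fun p _ ↦ mul_nonneg ?_ ?_
      · rw [map_add, coeff_one, coeff_X_pow]; split_ifs <;> simp
      · rw [geomSeries, coeff_mk]; split_ifs <;> simp
    rw [partialOver, Finset.prod_range_succ, coeff_mul]
    exact Finset.sum_nonneg fun p _ ↦ mul_nonneg (ih _) (h1 _)

theorem monotone_coeff_partialOver (n : ℕ) : Monotone fun N ↦ coeff n (partialOver N) := by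
  refine monotone_nat_of_le_succ fun N ↦ ?_
  have h1 : ∀ k, 0 ≤ coeff k ((1 + X ^ (N + 1)) * geomSeries (N + 1) : ℝ⟦X⟧) := by
    intro k
    rw [coeff_mul]
    refine Finset.sum_nonneg fun p _ ↦ mul_nonneg ?_ ?_
    · rw [map_add, coeff_one, coeff_X_pow]; split_ifs <;> simp
    · rw [geomSeries, coeff_mk]; split_ifs <;> simp
  have h2 : coeff 0 ((1 + X ^ (N + 1)) * geomSeries (N + 1) : ℝ⟦X⟧) = 1 := by
    simp [geomSeries]
  conv_rhs => rw [partialOver, Finset.prod_range_succ, coeff_mul]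
  have := Finset.single_le_sum (f := fun p : ℕ × ℕ ↦ coeff p.1 (partialOver N) *
    coeff p.2 ((1 + X ^ (N + 1)) * geomSeries (N + 1) : ℝ⟦X⟧))
    (fun p _ ↦ mul_nonneg (coeff_partialOver_nonneg _ _) (h1 _))
    (show (n, 0) ∈ Finset.HasAntidiagonal.antidiagonal n by simp)
  rw [h2, mul_one] at this
  exact this

theorem coeff_partialOver_le (N n : ℕ) : coeff n (partialOver N) ≤ pbar n :=
  (monotone_coeff_partialOver n).ge_of_tendsto (tendsto_coeff_partialOver n) N

theorem absEval_partialOver (N : ℕ) {z : ℂ} (hz : ‖z‖ < 1) :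
    AbsEval (partialOver N) z (∏ i ∈ Finset.range N, ((1 + z ^ (i + 1)) / (1 - z ^ (i + 1)))) := by
  induction N with
  | zero => simpa [partialOver] using absEval_one z
  | succ N ih =>
    rw [partialOver, Finset.prod_range_succ, Finset.prod_range_succ, div_eq_mul_inv (1 + _)]
    exact ih.mul ((absEval_one_add_X_pow N.succ_ne_zero z).mul
      (absEval_geomSeries N.succ_ne_zero hz))

end PowerSeriesEvaluation

theorem eulerProd_ne_zero {z : ℂ} (hz : ‖z‖ < 1) : eulerProd z ≠ 0 := by
  have := tprod_one_add_ne_zero_of_summable (f := fun n : ℕ ↦ -z ^ (n + 1)) ?_ ?_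
  · simpa [eulerProd, sub_eq_add_neg] using this
  · intro i h
    have h1 : ‖z ^ (i + 1)‖ < 1 := by
      rw [norm_pow]; exact pow_lt_one₀ (norm_nonneg _) hz i.succ_ne_zero
    have h2 : z ^ (i + 1) = 1 := by linear_combination -h
    rw [h2] at h1
    simp at h1
  · simpa using (summable_nat_add_iff 1).mpr (summable_geometric_of_lt_one (norm_nonneg _) hz)

theorem one_sub_pow_ne_zero {z : ℂ} (hz : ‖z‖ < 1) (i : ℕ) : 1 - z ^ (i + 1) ≠ 0 := by
  intro h
  have h1 : ‖z ^ (i + 1)‖ < 1 := by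
    rw [norm_pow]; exact pow_lt_one₀ (norm_nonneg _) hz i.succ_ne_zero
  rw [← sub_eq_zero.mp h] at h1
  simp at h1

theorem tendsto_prod_overGen {z : ℂ} (hz : ‖z‖ < 1) :
    Tendsto (fun N ↦ ∏ i ∈ Finset.range N, ((1 + z ^ (i + 1)) / (1 - z ^ (i + 1)))) atTop
      (𝓝 (overGen z)) := by
  have hz2 : ‖z ^ 2‖ < 1 := by
    rw [norm_pow]; exact pow_lt_one₀ (norm_nonneg _) hz two_ne_zero
  have h1 := (ModularForm.multipliable_one_sub_pow hz).hasProd.tendsto_prod_nat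
  have h2 := (ModularForm.multipliable_one_sub_pow hz2).hasProd.tendsto_prod_nat
  refine (h2.div (h1.pow 2) (pow_ne_zero 2 (eulerProd_ne_zero hz))).congr fun N ↦ ?_
  rw [Pi.div_apply, ← Finset.prod_pow, ← Finset.prod_div_distrib]
  refine Finset.prod_congr rfl fun i _ ↦ ?_
  have h0 := one_sub_pow_ne_zero hz i
  field_simp
  ring

theorem overGen_ofReal_eq_norm {r : ℝ} (h0 : 0 ≤ r) (h1 : r < 1) :
    Tendsto (fun N ↦ ∏ i ∈ Finset.range N, ((1 + r ^ (i + 1)) / (1 - r ^ (i + 1)))) atTop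
      (𝓝 ‖overGen r‖) := by
  have hr : ‖(r : ℂ)‖ < 1 := by simpa [abs_of_nonneg h0] using h1
  refine (tendsto_prod_overGen hr).norm.congr fun N ↦ ?_
  rw [norm_prod]
  refine Finset.prod_congr rfl fun i _ ↦ ?_
  have h2 : r ^ (i + 1) < 1 := pow_lt_one₀ h0 h1 i.succ_ne_zero
  have h3 : 0 ≤ r ^ (i + 1) := by positivity
  have h4 : (1 + (r : ℂ) ^ (i + 1)) / (1 - (r : ℂ) ^ (i + 1)) =
      (((1 + r ^ (i + 1)) / (1 - r ^ (i + 1)) : ℝ) : ℂ) := by push_cast; rfl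
  rw [h4, Complex.norm_real, Real.norm_of_nonneg]
  exact div_nonneg (by linarith) (by linarith)

theorem summable_pbar_mul_pow {r : ℝ} (h0 : 0 ≤ r) (h1 : r < 1) :
    Summable fun n ↦ (pbar n : ℝ) * r ^ n := by
  have hr : ‖(r : ℂ)‖ < 1 := by simpa [abs_of_nonneg h0] using h1
  obtain ⟨C, hC⟩ := (tendsto_prod_overGen hr).norm.bddAbove_range
  refine summable_of_sum_range_le (c := C) (fun n ↦ by positivity) fun M ↦ ?_
  have hlim : Tendsto (fun N ↦ ∑ n ∈ Finset.range M, PowerSeries.coeff n (partialOver N) * r ^ n)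
      atTop (𝓝 (∑ n ∈ Finset.range M, (pbar n : ℝ) * r ^ n)) :=
    tendsto_finsetSum _ fun n _ ↦ (tendsto_coeff_partialOver n).mul_const _
  refine le_of_tendsto' hlim fun N ↦ ?_
  have hs := absEval_partialOver N hr
  have hs1 : HasSum (fun n ↦ PowerSeries.coeff n (partialOver N) * r ^ n)
      (∏ i ∈ Finset.range N, ((1 + r ^ (i + 1)) / (1 - r ^ (i + 1)))) := by
    have := hs.2
    rw [← Complex.hasSum_ofReal]
    push_cast
    exact this
  refine le_trans (sum_le_hasSum _ (fun n _ ↦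
    mul_nonneg (coeff_partialOver_nonneg N n) (by positivity)) hs1) ?_
  refine le_trans (le_abs_self _) (le_trans (le_of_eq ?_) (hC ⟨N, rfl⟩))
  rw [← Real.norm_eq_abs, ← Complex.norm_real]
  push_cast
  rfl

theorem hasSum_pbar_mul_pow {z : ℂ} (hz : ‖z‖ < 1) :
    HasSum (fun n ↦ (pbar n : ℂ) * z ^ n) (overGen z) := by
  have hsum := summable_pbar_mul_pow (norm_nonneg z) hz
  have hlim := tendsto_tsum_of_dominated_convergence (𝓕 := atTop)
    (f := fun N n ↦ ((PowerSeries.coeff n (partialOver N) : ℝ) : ℂ) * z ^ n)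
    (g := fun n ↦ (pbar n : ℂ) * z ^ n) hsum
    (fun n ↦ by
      have := (Complex.continuous_ofReal.tendsto _).comp (tendsto_coeff_partialOver n)
      simpa using this.mul_const (z ^ n))
    (Eventually.of_forall fun N n ↦ by
      rw [norm_mul, norm_pow, Complex.norm_real, Real.norm_of_nonneg (coeff_partialOver_nonneg N n)]
      exact mul_le_mul_of_nonneg_right (coeff_partialOver_le N n) (by positivity))
  have heq := tendsto_nhds_unique
    (hlim.congr fun N ↦ (absEval_partialOver N hz).2.tsum_eq) (tendsto_prod_overGen hz)
  rw [← heq]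
  refine Summable.hasSum (Summable.of_norm ?_)
  simpa using hsum

theorem hasSum_log_one_add_sub_log_one_sub {z : ℂ} (hz : ‖z‖ < 1) :
    HasSum (fun n : ℕ ↦ (((1 - (-1) ^ n) / n : ℝ) : ℂ) * z ^ n)
      (Complex.log (1 + z) - Complex.log (1 - z)) := by
  have h1 := Complex.hasSum_taylorSeries_neg_log hz
  have h2 := Complex.hasSum_taylorSeries_neg_log (z := -z) (by simpa using hz)
  have h := h1.sub h2
  rw [sub_neg_eq_add, sub_neg_eq_add, neg_add_eq_sub] at h
  refine h.congr_fun ?_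
  intro n
  push_cast
  rw [neg_pow z n]
  ring

theorem norm_one_add_div_one_sub_eq_exp {z : ℂ} (hz : ‖z‖ < 1) :
    ‖(1 + z) / (1 - z)‖ = Real.exp (Complex.log (1 + z) - Complex.log (1 - z)).re := by
  have h1 : 1 + z ≠ 0 := by
    intro h
    rw [show z = -1 by linear_combination h] at hz
    simp at hz
  have h2 : 1 - z ≠ 0 := by
    intro h
    rw [show z = 1 by linear_combination -h] at hz
    simp at hz
  rw [← Complex.norm_exp, Complex.exp_sub, Complex.exp_log h1, Complex.exp_log h2]

theorem norm_one_add_div_one_sub_le {z : ℂ} (hz : ‖z‖ < 1) :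
    ‖(1 + z) / (1 - z)‖ ≤ (1 + ‖z‖) / (1 - ‖z‖) * Real.exp (-2 * (‖z‖ - z.re)) := by
  have hr : ‖((‖z‖ : ℝ) : ℂ)‖ < 1 := by simpa using hz
  have e1 := norm_one_add_div_one_sub_eq_exp hz
  have e2 := norm_one_add_div_one_sub_eq_exp hr
  have e3 : ‖(1 + ((‖z‖ : ℝ) : ℂ)) / (1 - ((‖z‖ : ℝ) : ℂ))‖ = (1 + ‖z‖) / (1 - ‖z‖) := by
    rw [← Complex.ofReal_one, ← Complex.ofReal_add, ← Complex.ofReal_sub, ← Complex.ofReal_div,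
      Complex.norm_real, Real.norm_of_nonneg]
    exact div_nonneg (by positivity) (by linarith)
  rw [e1, ← e3, e2, ← Real.exp_add, Real.exp_le_exp]
  have s1 := Complex.hasSum_re (hasSum_log_one_add_sub_log_one_sub hz)
  have s2 := Complex.hasSum_re (hasSum_log_one_add_sub_log_one_sub hr)
  have s := s2.sub s1
  have hle := le_hasSum s 1 fun n _ ↦ ?_
  · simp only [pow_one, Complex.re_ofReal_mul, Complex.ofReal_re] at hle
    norm_num at hle
    norm_num
    linarith
  · rw [Complex.re_ofReal_mul, Complex.re_ofReal_mul, ← mul_sub]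
    refine mul_nonneg (div_nonneg ?_ (by positivity)) ?_
    · rcases neg_one_pow_eq_or ℝ n with h | h <;> rw [h] <;> norm_num
    · rw [← Complex.ofReal_pow, Complex.ofReal_re, ← norm_pow, sub_nonneg]
      exact Complex.re_le_norm _

theorem norm_overGen_le {z : ℂ} (hz : ‖z‖ < 1) :
    ‖overGen z‖ ≤ ‖overGen ((‖z‖ : ℝ) : ℂ)‖ *
      Real.exp (-2 * (‖z‖ / (1 - ‖z‖) - (z / (1 - z)).re)) := by
  have hr : ‖‖z‖‖ < 1 := by simpa using hz
  have l1 : Tendsto (fun N ↦ ∑ i ∈ Finset.range N, ‖z‖ ^ (i + 1)) atTop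
      (𝓝 (‖z‖ / (1 - ‖z‖))) := by
    have := ((hasSum_geometric_of_norm_lt_one hr).mul_left ‖z‖).tendsto_sum_nat
    simpa [pow_succ', div_eq_mul_inv] using this
  have l2 : Tendsto (fun N ↦ ∑ i ∈ Finset.range N, (z ^ (i + 1)).re) atTop
      (𝓝 (z / (1 - z)).re) := by
    have := (Complex.hasSum_re ((hasSum_geometric_of_norm_lt_one hz).mul_left z)).tendsto_sum_nat
    simpa [pow_succ', div_eq_mul_inv] using this
  have l3 := (overGen_ofReal_eq_norm (norm_nonneg z) hz).mul
    ((Real.continuous_exp.tendsto _).comp ((l1.sub l2).const_mul (-2)))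
  refine le_of_tendsto_of_tendsto' (tendsto_prod_overGen hz).norm l3 fun N ↦ ?_
  simp only [Function.comp_apply]
  rw [norm_prod, ← Finset.sum_sub_distrib, Finset.mul_sum, Real.exp_sum, ← Finset.prod_mul_distrib]
  refine Finset.prod_le_prod (fun _ _ ↦ norm_nonneg _) fun i _ ↦ ?_
  have hzi : ‖z ^ (i + 1)‖ < 1 := by
    rw [norm_pow]; exact pow_lt_one₀ (norm_nonneg _) hz i.succ_ne_zero
  simpa [norm_pow] using norm_one_add_div_one_sub_le hzi

theorem integral_exp_int_mul_I (m : ℤ) :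
    ∫ y in (-π)..π, Complex.exp (m * Complex.I * y) = if m = 0 then 2 * (π : ℂ) else 0 := by
  split_ifs with h
  · simp [h]
    ring
  · rw [integral_exp_mul_complex (by simpa using h), div_eq_zero_iff]
    left
    rw [sub_eq_zero, Complex.exp_eq_exp_iff_exists_int]
    exact ⟨m, by push_cast; ring⟩

theorem norm_exp_neg_add_mul_I (c y : ℝ) :
    ‖Complex.exp (-(c + y * Complex.I))‖ = Real.exp (-c) := by
  simp [Complex.norm_exp]

theorem continuous_overGen_exp {c : ℝ} (hc : 0 < c) :
    Continuous fun y : ℝ ↦ overGen (Complex.exp (-(c + y * Complex.I))) := by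
  have hE : ContinuousOn eulerProd (Metric.ball 0 1) :=
    ModularForm.differentiableOn_tprod_one_sub_pow.continuousOn
  have hlt : ∀ y : ℝ, ‖Complex.exp (-(c + y * Complex.I))‖ < 1 := fun y ↦ by
    rw [norm_exp_neg_add_mul_I]; simpa using hc
  have hcont : Continuous fun y : ℝ ↦ Complex.exp (-(c + y * Complex.I)) := by fun_prop
  refine Continuous.div ?_ (Continuous.pow ?_ 2) fun y ↦ pow_ne_zero 2 (eulerProd_ne_zero (hlt y))
  · refine hE.comp_continuous (hcont.pow 2) fun y ↦ ?_
    simpa using hlt y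
  · exact hE.comp_continuous hcont fun y ↦ by simpa using hlt y

/-- Cauchy's formula for the coefficients, on the circle of radius `exp (-c)`. -/
theorem pbar_eq_integral (n : ℕ) {c : ℝ} (hc : 0 < c) :
    (pbar n : ℂ) = (1 / (2 * π)) * ∫ y in (-π)..π,
      overGen (Complex.exp (-(c + y * Complex.I))) * Complex.exp (n * (c + y * Complex.I)) := by
  have hlt : ∀ y : ℝ, ‖Complex.exp (-(c + y * Complex.I))‖ < 1 := fun y ↦ by
    rw [norm_exp_neg_add_mul_I]; simpa using hc
  have hs := summable_pbar_mul_pow (Real.exp_pos (-c)).le (by simpa using hc)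
  have h := intervalIntegral.hasSum_integral_of_dominated_convergence (a := -π) (b := π)
    (μ := MeasureTheory.volume)
    (F := fun (k : ℕ) (y : ℝ) ↦ ((pbar k : ℂ) * Complex.exp (-(c + y * Complex.I)) ^ k) *
      Complex.exp (n * (c + y * Complex.I)))
    (f := fun y ↦ overGen (Complex.exp (-(c + y * Complex.I))) *
      Complex.exp (n * (c + y * Complex.I)))
    (fun k _ ↦ (pbar k * Real.exp (-c) ^ k) * Real.exp (n * c))
    (fun k ↦ Continuous.aestronglyMeasurable (by fun_prop))
    (fun k ↦ Eventually.of_forall fun y _ ↦ by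
      rw [norm_mul, norm_mul, norm_pow, norm_exp_neg_add_mul_I, Complex.norm_exp]
      simp)
    (Eventually.of_forall fun y _ ↦ hs.mul_right _)
    intervalIntegrable_const
    (Eventually.of_forall fun y _ ↦ (hasSum_pbar_mul_pow (hlt y)).mul_right _)
  have hterm : ∀ k : ℕ, ∫ y in (-π)..π, ((pbar k : ℂ) *
      Complex.exp (-(c + y * Complex.I)) ^ k) * Complex.exp (n * (c + y * Complex.I)) =
      if k = n then 2 * (π : ℂ) * pbar n else 0 := by
    intro k
    have e : ∀ y : ℝ, ((pbar k : ℂ) * Complex.exp (-(c + y * Complex.I)) ^ k) *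
        Complex.exp (n * (c + y * Complex.I)) =
        (pbar k * Complex.exp ((n - k) * c)) *
          Complex.exp (((n - k : ℤ) : ℂ) * Complex.I * y) := by
      intro y
      rw [← Complex.exp_nat_mul, mul_assoc, mul_assoc, ← Complex.exp_add, ← Complex.exp_add]
      congr 2
      push_cast
      ring
    simp_rw [e]
    rw [intervalIntegral.integral_const_mul, integral_exp_int_mul_I]
    by_cases hk : k = n
    · subst hk
      simp
      ring
    · have : ((n : ℤ) - k) ≠ 0 := by omega
      simp [hk, this]
  simp_rw [hterm] at h
  have h' := h.unique (hasSum_ite_eq n _)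
  rw [h']
  have : (π : ℂ) ≠ 0 := by exact_mod_cast Real.pi_ne_zero
  field_simp

theorem eta_eq_exp_mul_eulerProd (z : ℂ) :
    ModularForm.eta z =
      Complex.exp (2 * π * Complex.I * z / 24) * eulerProd (Complex.exp (2 * π * Complex.I * z)) := by
  simp [ModularForm.eta, ModularForm.eta_q_eq_pow, eulerProd, Function.Periodic.qParam]

theorem sqrt_I_mul_sqrt_pi_mul_I_div {t : ℂ} (ht : 0 < t.re) :
    Complex.sqrt Complex.I * Complex.sqrt (π * Complex.I / t) =
      Complex.I * √π / Complex.sqrt t := by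
  have ht0 : t ≠ 0 := by rintro rfl; simp at ht
  have hpi : (π : ℂ) ≠ 0 := by exact_mod_cast Real.pi_ne_zero
  have hne : (π : ℂ) * Complex.I / t ≠ 0 := by simp [ht0, hpi]
  have harg := abs_lt.mp (Complex.abs_arg_lt_pi_div_two_iff.mpr (Or.inl ht))
  have hexp : Complex.exp ((Real.log π : ℂ) + π / 2 * Complex.I - Complex.log t) =
      π * Complex.I / t := by
    rw [Complex.exp_sub, Complex.exp_add, Complex.exp_log ht0, Complex.exp_pi_div_two_mul_I,
      ← Complex.ofReal_exp, Real.exp_log Real.pi_pos]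
  have hlog : Complex.log (π * Complex.I / t) =
      (Real.log π : ℂ) + π / 2 * Complex.I - Complex.log t := by
    have him : ((Real.log π : ℂ) + π / 2 * Complex.I - Complex.log t).im = π / 2 - t.arg := by
      have : (π / 2 * Complex.I : ℂ).im = π / 2 := by
        rw [show (π / 2 * Complex.I : ℂ) = ((π / 2 : ℝ) : ℂ) * Complex.I by push_cast; ring]
        rw [Complex.im_ofReal_mul]
        simp
      simp only [Complex.sub_im, Complex.add_im, Complex.ofReal_im, Complex.log_im, this]
      ring
    rw [← hexp, Complex.log_exp]
    · rw [him]; linarith [Real.pi_pos]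
    · rw [him]; linarith
  have hsq : ((√π : ℝ) : ℂ) = Complex.exp ((Real.log π : ℂ) / 2) := by
    rw [Real.sqrt_eq_rpow, Real.rpow_def_of_pos Real.pi_pos]
    push_cast
    ring_nf
  rw [sqrt_eq_exp Complex.I_ne_zero, sqrt_eq_exp hne, sqrt_eq_exp ht0, hlog, Complex.log_I, hsq]
  conv_rhs => rw [← Complex.exp_pi_div_two_mul_I]
  rw [← Complex.exp_add, ← Complex.exp_add, ← Complex.exp_sub]
  ring_nf

theorem sqrt_sq {z : ℂ} (hz : z ≠ 0) : Complex.sqrt z ^ 2 = z := by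
  rw [sqrt_eq_exp hz, ← Complex.exp_nat_mul]
  push_cast
  rw [mul_div_cancel₀ _ two_ne_zero, Complex.exp_log hz]

/-- The behaviour of the generating function of overpartitions near `1`. -/
theorem overGen_exp_neg {t : ℂ} (ht : 0 < t.re) :
    overGen (Complex.exp (-t)) = Complex.sqrt t / (2 * √π) * Complex.exp (π ^ 2 / (4 * t)) *
      (eulerProd (Complex.exp (-(2 * π ^ 2 / t))) /
        eulerProd (Complex.exp (-(2 * π ^ 2 / t)) ^ 2) ^ 2) := by
  have ht0 : t ≠ 0 := by rintro rfl; simp at ht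
  have hpi : (π : ℂ) ≠ 0 := by exact_mod_cast Real.pi_ne_zero
  have hinv : 0 < (t⁻¹).re := by
    rw [Complex.inv_re]; exact div_pos ht (Complex.normSq_pos.mpr ht0)
  have him : ∀ a : ℝ, 0 < a → 0 < (a * Complex.I / t).im := by
    intro a ha
    rw [show (a * Complex.I / t : ℂ) = a * (Complex.I * t⁻¹) by ring, Complex.im_ofReal_mul]
    simpa using mul_pos ha hinv
  have h1 := ModularForm.eta_comp_eq_csqrt_I_inv (x := ((2 * π : ℝ) : ℂ) * Complex.I / t)
    (him _ (by positivity))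
  have h2 := ModularForm.eta_comp_eq_csqrt_I_inv (x := (π : ℂ) * Complex.I / t)
    (him _ Real.pi_pos)
  simp only [Function.comp_apply, Pi.smul_apply, Pi.mul_apply, smul_eq_mul] at h1 h2
  rw [eta_eq_exp_mul_eulerProd, eta_eq_exp_mul_eulerProd] at h1 h2
  push_cast at h1
  have hI := Complex.I_sq
  have e1 : 2 * π * Complex.I * (-1 / (2 * π * Complex.I / t)) = -t := by
    field_simp [Complex.I_ne_zero]
  have e2 : 2 * π * Complex.I * (-1 / (π * Complex.I / t)) = -t * 2 := by
    field_simp [Complex.I_ne_zero]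
  have e3 : 2 * π * Complex.I * (2 * π * Complex.I / t) = -(2 * π ^ 2 / t) * 2 := by
    field_simp
    linear_combination hI
  have e4 : 2 * π * Complex.I * (π * Complex.I / t) = -(2 * π ^ 2 / t) := by
    field_simp
    linear_combination hI
  rw [e1, e3] at h1
  rw [e2, e4] at h2
  have hsq : Complex.exp (-(2 * π ^ 2 / t)) ^ 2 = Complex.exp (-(2 * π ^ 2 / t) * 2) := by
    rw [← Complex.exp_nat_mul]; push_cast; ring_nf
  have hsq' : Complex.exp (-t) ^ 2 = Complex.exp (-t * 2) := by
    rw [← Complex.exp_nat_mul]; push_cast; ring_nf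
  have hE : Complex.exp (-t * 2 / 24) = Complex.exp (-t / 24) ^ 2 := by
    rw [← Complex.exp_nat_mul]; push_cast; ring_nf
  have hF : Complex.exp (-(2 * π ^ 2 / t) * 2 / 24) = Complex.exp (-(2 * π ^ 2 / t) / 24) ^ 2 := by
    rw [← Complex.exp_nat_mul]; push_cast; ring_nf
  have hG : Complex.exp (π ^ 2 / (4 * t)) * Complex.exp (-(2 * π ^ 2 / t) / 24) ^ 3 = 1 := by
    rw [← Complex.exp_nat_mul, ← Complex.exp_add]
    push_cast
    rw [show (π : ℂ) ^ 2 / (4 * t) + 3 * (-(2 * π ^ 2 / t) / 24) = 0 by field_simp; ring,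
      Complex.exp_zero]
  have hnorm : ‖Complex.exp (-t)‖ < 1 := by
    rw [Complex.norm_exp]; simpa using ht
  have hA := eulerProd_ne_zero hnorm
  have hw : ‖Complex.exp (-(2 * π ^ 2 / t) * 2)‖ < 1 := by
    rw [Complex.norm_exp, Real.exp_lt_one_iff]
    rw [show (-(2 * π ^ 2 / t) * 2 : ℂ) = ((-(4 * π ^ 2) : ℝ) : ℂ) * t⁻¹ by push_cast; ring,
      Complex.re_ofReal_mul]
    exact mul_neg_of_neg_of_pos (by have := Real.pi_pos; nlinarith) hinv
  have hD := eulerProd_ne_zero hw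
  have hS := sqrt_I_mul_sqrt_pi_mul_I_div ht
  have hst : Complex.sqrt t ≠ 0 := fun h => ht0 (by rw [← sqrt_sq ht0, h]; simp)
  have hsI : Complex.sqrt Complex.I ≠ 0 := fun h =>
    Complex.I_ne_zero (by rw [← sqrt_sq Complex.I_ne_zero, h]; simp)
  have hz1 : 2 * π * Complex.I / t ≠ 0 := by simp [ht0, hpi]
  have hS1 := sqrt_sq hz1
  have ht2 := sqrt_sq ht0
  have hp2 : ((√π : ℝ) : ℂ) ^ 2 = π := by
    rw [← Complex.ofReal_pow, Real.sq_sqrt Real.pi_pos.le]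
  have hpne : ((√π : ℝ) : ℂ) ≠ 0 := by intro h; rw [h] at hp2; simp at hp2; exact hpi hp2.symm
  rw [overGen, hsq, hsq']
  rw [hF] at h1
  rw [hE] at h2
  have hE0 := Complex.exp_ne_zero (-t / 24)
  have hF0 := Complex.exp_ne_zero (-(2 * π ^ 2 / t) / 24)
  have hG0 := Complex.exp_ne_zero (π ^ 2 / (4 * t))
  generalize Complex.exp (-t / 24) = E at *
  generalize Complex.exp (-(2 * π ^ 2 / t) / 24) = F at *
  generalize Complex.exp (π ^ 2 / (4 * t)) = G at *
  generalize eulerProd (Complex.exp (-t)) = A at *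
  generalize eulerProd (Complex.exp (-t * 2)) = B at *
  generalize eulerProd (Complex.exp (-(2 * π ^ 2 / t))) = C at *
  generalize eulerProd (Complex.exp (-(2 * π ^ 2 / t) * 2)) = D at *
  generalize Complex.sqrt (2 * π * Complex.I / t) = S at *
  generalize Complex.sqrt (π * Complex.I / t) = R at *
  generalize Complex.sqrt Complex.I = J at *
  generalize Complex.sqrt t = T at *
  generalize ((√π : ℝ) : ℂ) = P at *
  have hA' : A = J⁻¹ * S * F ^ 2 * D / E := by
    field_simp at h1 ⊢; linear_combination h1
  have hB' : B = J⁻¹ * R * F * C / E ^ 2 := by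
    field_simp at h2 ⊢; linear_combination h2
  have hG' : G = (F ^ 3)⁻¹ := by field_simp; exact hG
  have hR : R = Complex.I * P / T / J := by rw [← hS]; field_simp
  have hS0 : S ≠ 0 := fun h => hz1 (by rw [← hS1, h]; simp)
  have hS2 : S ^ 2 = 2 * P ^ 2 * Complex.I / T ^ 2 := by rw [hS1, ht2, hp2]
  have hI0 := Complex.I_ne_zero
  calc B / A ^ 2 = J * R * C / (S ^ 2 * F ^ 3 * D ^ 2) := by
        rw [hA', hB']; field_simp
    _ = _ := by rw [hS2, hR, hG']; field_simp

theorem norm_eulerProd_sub_one_le {w : ℂ} (hw : ‖w‖ ≤ 1 / 16) :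
    ‖eulerProd w - 1‖ ≤ 2 * ‖w‖ := by
  have hw1 : ‖w‖ < 1 := by linarith
  have hm : Multipliable fun i : ℕ => 1 - w ^ (i + 1) :=
    ModularForm.multipliable_one_sub_pow hw1
  have hlim := (hm.hasProd.tendsto_prod_nat.sub_const 1).norm
  refine le_of_tendsto hlim (Filter.Eventually.of_forall fun N => ?_)
  have h0 := norm_nonneg w
  have hsum : ∑ i ∈ Finset.range N, ‖-w ^ (i + 1)‖ ≤ 16 / 15 * ‖w‖ := by
    have hg : HasSum (fun i : ℕ => ‖-w ^ (i + 1)‖) (‖w‖ * (1 - ‖w‖)⁻¹) := by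
      simpa [pow_succ'] using (hasSum_geometric_of_lt_one h0 hw1).mul_left ‖w‖
    refine (sum_le_hasSum _ (fun i _ => norm_nonneg _) hg).trans ?_
    rw [← div_eq_mul_inv, div_le_iff₀ (by linarith)]
    nlinarith
  have hexp := abs_le.mp (Real.abs_exp_sub_one_sub_id_le (x := 16 / 15 * ‖w‖)
    (by rw [abs_of_nonneg (by positivity)]; linarith))
  calc ‖∏ i ∈ Finset.range N, (1 - w ^ (i + 1)) - 1‖
      = ‖∏ i ∈ Finset.range N, (1 + -w ^ (i + 1)) - 1‖ := by simp only [sub_eq_add_neg]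
    _ ≤ Real.exp (∑ i ∈ Finset.range N, ‖-w ^ (i + 1)‖) - 1 :=
        Finset.norm_prod_one_add_sub_one_le _ _
    _ ≤ Real.exp (16 / 15 * ‖w‖) - 1 := by gcongr
    _ ≤ 2 * ‖w‖ := by nlinarith [hexp.2]

theorem norm_eulerProd_div_sub_one_le {w : ℂ} (hw : ‖w‖ ≤ 1 / 16) :
    ‖eulerProd w / eulerProd (w ^ 2) ^ 2 - 1‖ ≤ 4 * ‖w‖ := by
  have h0 := norm_nonneg w
  have hw2 : ‖w ^ 2‖ ≤ ‖w‖ / 16 := by rw [norm_pow]; nlinarith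
  have hC := norm_eulerProd_sub_one_le hw
  have hD := norm_eulerProd_sub_one_le (w := w ^ 2) (by linarith)
  have hD0 : eulerProd (w ^ 2) ≠ 0 := eulerProd_ne_zero (by linarith)
  generalize eulerProd w = C at *
  generalize eulerProd (w ^ 2) = D at *
  have hD' : 1 - ‖D - 1‖ ≤ ‖D‖ := by
    have := norm_sub_norm_le (1 : ℂ) (1 - D)
    rw [norm_one, norm_sub_rev, sub_sub_cancel] at this
    exact this
  have hDle : ‖D + 1‖ ≤ 2 + ‖D - 1‖ := by
    calc ‖D + 1‖ = ‖2 + (D - 1)‖ := by ring_nf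
      _ ≤ ‖(2 : ℂ)‖ + ‖D - 1‖ := norm_add_le _ _
      _ = _ := by simp
  have hnum : ‖C - D ^ 2‖ ≤ 9 / 4 * ‖w‖ + ‖w‖ / 8 := by
    calc ‖C - D ^ 2‖ = ‖(C - 1) - (D + 1) * (D - 1)‖ := by ring_nf
      _ ≤ ‖C - 1‖ + ‖D + 1‖ * ‖D - 1‖ := by
          rw [← norm_mul]; exact norm_sub_le _ _
      _ ≤ _ := by nlinarith [norm_nonneg (D - 1), norm_nonneg (D + 1)]
  rw [div_sub_one (pow_ne_zero 2 hD0), norm_div, norm_pow,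
    div_le_iff₀ (by have := norm_pos_iff.mpr hD0; positivity)]
  have : (9 / 10 : ℝ) ≤ ‖D‖ := by linarith
  nlinarith [mul_le_mul this this (by norm_num) (norm_nonneg D)]

theorem exists_hasDerivAt_exp_sq :
    ∃ W : ℂ → ℂ, ∀ z, HasDerivAt W (Complex.exp (z ^ 2)) z := by
  have hd : Differentiable ℂ fun z : ℂ => Complex.exp (z ^ 2) := by fun_prop
  obtain ⟨W, hW⟩ := hd.isExactOn_univ
  exact ⟨W, fun z => hW z (Set.mem_univ z)⟩

theorem abs_integral_exp_neg_sq_sub_le {y : ℝ} (hy : 1 ≤ y) :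
    |(∫ x in (0 : ℝ)..y, Real.exp (-x ^ 2)) - √π / 2| ≤ Real.exp (-y ^ 2) := by
  have hint : MeasureTheory.Integrable fun x : ℝ => Real.exp (-x ^ 2) := by
    simpa using integrable_exp_neg_mul_sq (b := 1) one_pos
  have hfull : ∫ x in Set.Ioi (0 : ℝ), Real.exp (-x ^ 2) = √π / 2 := by
    simpa using integral_gaussian_Ioi 1
  have hsplit := intervalIntegral.integral_interval_add_Ioi (a := 0) (b := y)
    hint.integrableOn hint.integrableOn
  have htail : ∫ x in Set.Ioi y, Real.exp (-x ^ 2) ≤ Real.exp (-y ^ 2) := by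
    calc ∫ x in Set.Ioi y, Real.exp (-x ^ 2) ≤ ∫ x in Set.Ioi y, Real.exp (-y * x) := by
          refine MeasureTheory.setIntegral_mono_on hint.integrableOn
            (integrableOn_exp_mul_Ioi (by linarith) _) measurableSet_Ioi fun x hx => ?_
          have : y < x := hx
          gcongr
          nlinarith
      _ = Real.exp (-y ^ 2) / y := by
          rw [integral_exp_mul_Ioi (by linarith)]
          rw [div_neg, neg_div, neg_neg]
          ring_nf
      _ ≤ Real.exp (-y ^ 2) := div_le_self (Real.exp_pos _).le hy
  have hpos : 0 ≤ ∫ x in Set.Ioi y, Real.exp (-x ^ 2) :=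
    MeasureTheory.setIntegral_nonneg measurableSet_Ioi fun x _ => (Real.exp_pos _).le
  rw [← hfull, ← hsplit, sub_add_cancel_left, abs_neg, abs_of_nonneg hpos]
  exact htail

theorem norm_sub_sub_sqrt_pi_le {W : ℂ → ℂ}
    (hW : ∀ z, HasDerivAt W (Complex.exp (z ^ 2)) z) (x : ℝ) {y : ℝ}
    (hy : 1 ≤ y) :
    ‖W (x + y * Complex.I) - W 0 - Complex.I * (√π / 2 : ℝ)‖ ≤
      (|x| + 1) * Real.exp (x ^ 2 - y ^ 2) := by
  have hnorm : ∀ u : ℝ, ‖Complex.exp (((u : ℂ) + y * Complex.I) ^ 2)‖ = Real.exp (u ^ 2 - y ^ 2) := by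
    intro u
    rw [Complex.norm_exp]
    congr 1
    simp [sq]
  have hseg : ‖W (x + y * Complex.I) - W (y * Complex.I)‖ ≤ Real.exp (x ^ 2 - y ^ 2) * |x| := by
    have hderiv : ∀ u ∈ Set.uIcc 0 x, HasDerivWithinAt (fun u : ℝ => W (u + y * Complex.I))
        (Complex.exp ((u + y * Complex.I) ^ 2)) (Set.uIcc 0 x) u := by
      intro u _
      have h1 : HasDerivAt (fun u : ℂ => W (u + y * Complex.I))
          (Complex.exp ((u + y * Complex.I) ^ 2)) (u : ℂ) := by
        simpa using (hW (u + y * Complex.I)).comp_add_const (u : ℂ) (y * Complex.I)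
      exact h1.comp_ofReal.hasDerivWithinAt
    have := (convex_uIcc (0 : ℝ) x).norm_image_sub_le_of_norm_hasDerivWithin_le hderiv
      (C := Real.exp (x ^ 2 - y ^ 2)) (fun u hu => by
        rw [hnorm]
        gcongr 1
        have : |u - 0| ≤ |x - 0| := Set.abs_sub_left_of_mem_uIcc hu
        have := sq_le_sq.mpr (by simpa using this : |u| ≤ |x|)
        linarith) Set.left_mem_uIcc Set.right_mem_uIcc
    simpa using this
  have hvert : W (y * Complex.I) - W 0 =
      Complex.I * ((∫ x in (0 : ℝ)..y, Real.exp (-x ^ 2) : ℝ) : ℂ) := by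
    have hderiv : ∀ u ∈ Set.uIcc 0 y, HasDerivAt (fun u : ℝ => W (u * Complex.I))
        (Complex.I * ((Real.exp (-u ^ 2) : ℝ) : ℂ)) u := by
      intro u _
      have h1 : HasDerivAt (fun u : ℂ => W (u * Complex.I))
          (Complex.exp ((u * Complex.I) ^ 2) * (1 * Complex.I)) (u : ℂ) :=
        (hW (u * Complex.I)).comp (u : ℂ) ((hasDerivAt_id (u : ℂ)).mul_const Complex.I)
      convert h1.comp_ofReal using 1
      rw [mul_pow, Complex.I_sq]
      push_cast
      ring_nf
    have := intervalIntegral.integral_eq_sub_of_hasDerivAt hderiv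
      (Continuous.intervalIntegrable (by fun_prop) _ _)
    rw [intervalIntegral.integral_const_mul, intervalIntegral.integral_ofReal] at this
    rw [this]
    simp
  have htail := abs_integral_exp_neg_sq_sub_le hy
  calc ‖W (x + y * Complex.I) - W 0 - Complex.I * (√π / 2 : ℝ)‖
      = ‖(W (x + y * Complex.I) - W (y * Complex.I)) +
          Complex.I * (((∫ x in (0 : ℝ)..y, Real.exp (-x ^ 2)) - √π / 2 : ℝ) : ℂ)‖ := by
        congr 1
        push_cast at hvert ⊢
        linear_combination hvert
    _ ≤ Real.exp (x ^ 2 - y ^ 2) * |x| + Real.exp (-y ^ 2) := by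
        refine (norm_add_le _ _).trans (add_le_add hseg ?_)
        rw [norm_mul, Complex.norm_I, one_mul, Complex.norm_real]
        exact htail
    _ ≤ _ := by
        have : Real.exp (-y ^ 2) ≤ Real.exp (x ^ 2 - y ^ 2) := by
          gcongr; nlinarith [sq_nonneg x]
        linarith

theorem norm_sub_conj_sub_sqrt_pi_le {W : ℂ → ℂ}
    (hW : ∀ z, HasDerivAt W (Complex.exp (z ^ 2)) z) (x : ℝ)
    {y : ℝ} (hy : 1 ≤ y) :
    ‖W (x + y * Complex.I) - W (x - y * Complex.I) - Complex.I * √π‖ ≤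
      2 * (|x| + 1) * Real.exp (x ^ 2 - y ^ 2) := by
  have hW' : ∀ z, HasDerivAt (fun z => -W (-z)) (Complex.exp (z ^ 2)) z := by
    intro z
    have := ((hW (-z)).comp z (hasDerivAt_neg z)).neg
    rwa [mul_neg_one, neg_neg, neg_sq] at this
  have h1 := norm_sub_sub_sqrt_pi_le hW x hy
  have h2 := norm_sub_sub_sqrt_pi_le hW' (-x) hy
  have : W (x + y * Complex.I) - W (x - y * Complex.I) - Complex.I * √π =
      (W (x + y * Complex.I) - W 0 - Complex.I * (√π / 2 : ℝ)) +
      (-W (-(((-x : ℝ) : ℂ) + y * Complex.I)) - -W (-0) - Complex.I * (√π / 2 : ℝ)) := by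
    push_cast
    ring_nf
  rw [this]
  refine (norm_add_le _ _).trans ((add_le_add h1 h2).trans_eq ?_)
  rw [abs_neg, neg_sq]
  ring

theorem norm_sub_conj_le {W : ℂ → ℂ}
    (hW : ∀ z, HasDerivAt W (Complex.exp (z ^ 2)) z) (x : ℝ) {y : ℝ}
    (hy : 0 ≤ y) :
    ‖W (x + y * Complex.I) - W (x - y * Complex.I)‖ ≤ 2 * y * Real.exp (x ^ 2) := by
  have hderiv : ∀ u ∈ Set.Icc (-y) y, HasDerivWithinAt (fun u : ℝ => W (x + u * Complex.I))
      (Complex.exp ((x + u * Complex.I) ^ 2) * (1 * Complex.I)) (Set.Icc (-y) y) u := by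
    intro u _
    have h1 : HasDerivAt (fun u : ℂ => W (x + u * Complex.I))
        (Complex.exp ((x + u * Complex.I) ^ 2) * (1 * Complex.I)) (u : ℂ) :=
      (hW (x + u * Complex.I)).comp (u : ℂ)
        (((hasDerivAt_id (u : ℂ)).mul_const Complex.I).const_add (x : ℂ))
    exact h1.comp_ofReal.hasDerivWithinAt
  have := (convex_Icc (-y) y).norm_image_sub_le_of_norm_hasDerivWithin_le hderiv
    (C := Real.exp (x ^ 2)) (fun u _ => by
      rw [one_mul, norm_mul, Complex.norm_I, mul_one, Complex.norm_exp]
      gcongr 1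
      simp [sq]
      nlinarith [sq_nonneg u]) (Set.left_mem_Icc.mpr (by linarith))
      (Set.right_mem_Icc.mpr (by linarith))
  rw [Real.norm_eq_abs, sub_neg_eq_add, abs_of_nonneg (by linarith)] at this
  refine le_of_eq_of_le ?_ (this.trans_eq (by ring))
  push_cast
  ring_nf

theorem hasDerivAt_sqrt_inv {z : ℂ} (hz : z ∈ Complex.slitPlane) :
    HasDerivAt Complex.sqrt (1 / (2 * Complex.sqrt z)) z := by
  convert Complex.hasDerivAt_sqrt hz using 1
  rw [show (-1 / 2 : ℂ) = -(2⁻¹) by norm_num, Complex.cpow_neg, Complex.sqrt]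
  rw [one_div, mul_inv, div_eq_mul_inv, mul_comm]

theorem sqrt_one_add_mul_I : Complex.sqrt (1 + (15 / 8 : ℝ) * Complex.I) = (5 + 3 * Complex.I) / 4 := by
  have hn : ‖(1 + (15 / 8 : ℝ) * Complex.I : ℂ)‖ = 17 / 8 := by
    rw [Complex.norm_def, Complex.normSq_apply, Real.sqrt_eq_iff_mul_self_eq] <;> norm_num
  have h1 : √((17 / 8 + 1 : ℝ) / 2) = 5 / 4 := by
    rw [Real.sqrt_eq_iff_mul_self_eq] <;> norm_num
  have h2 : √((17 / 8 - 1 : ℝ) / 2) = 3 / 4 := by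
    rw [Real.sqrt_eq_iff_mul_self_eq] <;> norm_num
  rw [Complex.sqrt_eq_real_add_ite, hn]
  have hre : (1 + (15 / 8 : ℝ) * Complex.I : ℂ).re = 1 := by simp
  have him : (1 + (15 / 8 : ℝ) * Complex.I : ℂ).im = 15 / 8 := by simp
  rw [hre, him, h1, h2, if_pos (by norm_num)]
  push_cast
  ring

theorem sqrt_one_sub_mul_I :
    Complex.sqrt (1 + (-(15 / 8) : ℝ) * Complex.I) = (5 - 3 * Complex.I) / 4 := by
  have hn : ‖(1 + (-(15 / 8) : ℝ) * Complex.I : ℂ)‖ = 17 / 8 := by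
    rw [Complex.norm_def, Complex.normSq_apply, Real.sqrt_eq_iff_mul_self_eq] <;> norm_num
  have h1 : √((17 / 8 + 1 : ℝ) / 2) = 5 / 4 := by
    rw [Real.sqrt_eq_iff_mul_self_eq] <;> norm_num
  have h2 : √((17 / 8 - 1 : ℝ) / 2) = 3 / 4 := by
    rw [Real.sqrt_eq_iff_mul_self_eq] <;> norm_num
  rw [Complex.sqrt_eq_real_add_ite, hn]
  have hre : (1 + (-(15 / 8) : ℝ) * Complex.I : ℂ).re = 1 := by simp
  have him : (1 + (-(15 / 8) : ℝ) * Complex.I : ℂ).im = -(15 / 8) := by simp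
  rw [hre, him, h1, h2, if_neg (by norm_num)]
  push_cast
  ring

/-- A primitive of `s ↦ 2 * b ^ 2 * s ^ 2 * exp (b ^ 2 * (s ^ 2 + s⁻¹ ^ 2))`, where `W` is a
primitive of `z ↦ exp (z ^ 2)`. -/
noncomputable def saddlePrimitive (W : ℂ → ℂ) (b : ℝ) (s : ℂ) : ℂ :=
  s * Complex.exp (b ^ 2 * (s ^ 2 + s⁻¹ ^ 2)) +
    (b - 1 / (2 * b)) * Complex.exp (2 * b ^ 2) * W (b * (s - s⁻¹)) -
    (b + 1 / (2 * b)) * Complex.exp (-(2 * b ^ 2)) * W (b * (s + s⁻¹))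

theorem hasDerivAt_saddlePrimitive {W : ℂ → ℂ}
    (hW : ∀ z, HasDerivAt W (Complex.exp (z ^ 2)) z) {b : ℝ}
    (hb : 0 < b) {s : ℂ} (hs : s ≠ 0) :
    HasDerivAt (saddlePrimitive W b)
      (2 * b ^ 2 * s ^ 2 * Complex.exp (b ^ 2 * (s ^ 2 + s⁻¹ ^ 2))) s := by
  have hinv := hasDerivAt_inv hs
  have hE := ((((hasDerivAt_id s).pow 2).add (hinv.pow 2)).const_mul ((b : ℂ) ^ 2)).cexp
  have hu := ((hasDerivAt_id s).sub hinv).const_mul (b : ℂ)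
  have hv := ((hasDerivAt_id s).add hinv).const_mul (b : ℂ)
  have h := (((hasDerivAt_id s).mul hE).add
    (((hW (b * (s - s⁻¹))).comp s hu).const_mul ((b - 1 / (2 * b)) * Complex.exp (2 * b ^ 2)))).sub
    (((hW (b * (s + s⁻¹))).comp s hv).const_mul
      ((b + 1 / (2 * b)) * Complex.exp (-(2 * b ^ 2))))
  refine (h.congr_deriv ?_).congr_of_eventuallyEq (Filter.Eventually.of_forall fun z => ?_)
  · have hb' : (b : ℂ) ≠ 0 := by exact_mod_cast hb.ne'
    have e1 : Complex.exp (2 * b ^ 2) * Complex.exp ((b * (s - s⁻¹)) ^ 2) =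
        Complex.exp (b ^ 2 * (s ^ 2 + s⁻¹ ^ 2)) := by
      rw [← Complex.exp_add]; congr 1; field_simp; ring
    have e2 : Complex.exp (-(2 * b ^ 2)) * Complex.exp ((b * (s + s⁻¹)) ^ 2) =
        Complex.exp (b ^ 2 * (s ^ 2 + s⁻¹ ^ 2)) := by
      rw [← Complex.exp_add]; congr 1; field_simp; ring
    simp only [id, Pi.add_apply, Pi.pow_apply, Nat.cast_ofNat, Nat.add_one_sub_one, pow_one]
    linear_combination (norm := skip) (b - 1 / (2 * b)) * (b * (1 + (s ^ 2)⁻¹)) * e1 -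
      (b + 1 / (2 * b)) * (b * (1 - (s ^ 2)⁻¹)) * e2
    generalize Complex.exp (b ^ 2 * (s ^ 2 + s⁻¹ ^ 2)) = X
    generalize Complex.exp ((b * (s - s⁻¹)) ^ 2) = Y
    generalize Complex.exp ((b * (s + s⁻¹)) ^ 2) = Z
    generalize Complex.exp (2 * b ^ 2) = P
    generalize Complex.exp (-(2 * b ^ 2)) = Q
    field_simp
    ring
  · simp [saddlePrimitive]

theorem integral_sqrt_mul_exp {W : ℂ → ℂ}
    (hW : ∀ z, HasDerivAt W (Complex.exp (z ^ 2)) z) {b : ℝ}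
    (hb : 0 < b) :
    ∫ y in (-(15 / 8) : ℝ)..(15 / 8), Complex.sqrt (1 + y * Complex.I) *
        Complex.exp (b ^ 2 * ((1 + y * Complex.I) + (1 + y * Complex.I)⁻¹)) =
      (saddlePrimitive W b ((5 + 3 * Complex.I) / 4) -
        saddlePrimitive W b ((5 - 3 * Complex.I) / 4)) / (Complex.I * b ^ 2) := by
  have hb' : (b : ℂ) ≠ 0 := by exact_mod_cast hb.ne'
  have hslit : ∀ y : ℝ, (1 + y * Complex.I : ℂ) ∈ Complex.slitPlane := fun y => Or.inl (by simp)
  have hderiv : ∀ y ∈ Set.uIcc (-(15 / 8) : ℝ) (15 / 8),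
      HasDerivAt (fun y : ℝ => saddlePrimitive W b (Complex.sqrt (1 + y * Complex.I)))
        ((Complex.I * b ^ 2) * (Complex.sqrt (1 + y * Complex.I) *
          Complex.exp (b ^ 2 * ((1 + y * Complex.I) + (1 + y * Complex.I)⁻¹)))) y := by
    intro y _
    have hy0 : (1 + y * Complex.I : ℂ) ≠ 0 := Complex.slitPlane_ne_zero (hslit y)
    have hsq := sqrt_sq hy0
    have hs0 : Complex.sqrt (1 + y * Complex.I) ≠ 0 := fun h => hy0 (by rw [← hsq, h]; simp)
    have h1 : HasDerivAt (fun y : ℂ => 1 + y * Complex.I) (1 * Complex.I) (y : ℂ) :=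
      ((hasDerivAt_id (y : ℂ)).mul_const Complex.I).const_add 1
    have h2 := (hasDerivAt_sqrt_inv (hslit y)).comp (y : ℂ) h1
    have h3 := HasDerivAt.comp (y : ℂ) (h₂ := saddlePrimitive W b)
      (by exact hasDerivAt_saddlePrimitive hW hb hs0) h2
    refine h3.comp_ofReal.congr_deriv ?_
    rw [Function.comp_apply, inv_pow, hsq]
    generalize Complex.exp (b ^ 2 * ((1 + y * Complex.I) + (1 + y * Complex.I)⁻¹)) = X
    field_simp
    linear_combination -X * hsq
  have hint : IntervalIntegrable (fun y : ℝ => (Complex.I * b ^ 2) *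
      (Complex.sqrt (1 + y * Complex.I) *
        Complex.exp (b ^ 2 * ((1 + y * Complex.I) + (1 + y * Complex.I)⁻¹))))
      MeasureTheory.volume (-(15 / 8)) (15 / 8) := by
    refine Continuous.intervalIntegrable ?_ _ _
    have hc : Continuous fun y : ℝ => (1 + y * Complex.I : ℂ) := by fun_prop
    have hc1 : Continuous fun y : ℝ => Complex.sqrt (1 + y * Complex.I) :=
      Complex.continuousOn_sqrt.comp_continuous hc hslit
    have hc2 : Continuous fun y : ℝ => (1 + y * Complex.I : ℂ)⁻¹ :=
      hc.inv₀ fun y => Complex.slitPlane_ne_zero (hslit y)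
    fun_prop
  have h := intervalIntegral.integral_eq_sub_of_hasDerivAt hderiv hint
  rw [intervalIntegral.integral_const_mul, sqrt_one_add_mul_I, sqrt_one_sub_mul_I] at h
  rw [eq_div_iff (mul_ne_zero Complex.I_ne_zero (pow_ne_zero 2 hb')), mul_comm, h]

theorem norm_integral_sqrt_mul_exp_sub_le {b : ℝ} (hb : 2 ≤ b) :
    ‖(∫ y in (-(15 / 8) : ℝ)..(15 / 8), Complex.sqrt (1 + y * Complex.I) *
        Complex.exp (b ^ 2 * ((1 + y * Complex.I) + (1 + y * Complex.I)⁻¹))) -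
      ((b - 1 / (2 * b)) / b ^ 2 * √π * Real.exp (2 * b ^ 2) : ℝ)‖ ≤
      8 * Real.exp (7 / 5 * b ^ 2) := by
  obtain ⟨W, hW⟩ := exists_hasDerivAt_exp_sq
  have hb0 : 0 < b := by linarith
  have hb' : (b : ℂ) ≠ 0 := by exact_mod_cast hb0.ne'
  have hI0 := Complex.I_ne_zero
  have hI2 := Complex.I_sq
  have hpos : (5 + 3 * Complex.I) / 4 * ((10 - 6 * Complex.I) / 17) = 1 := by
    linear_combination (-18 / 68) * hI2
  have hneg : (5 - 3 * Complex.I) / 4 * ((10 + 6 * Complex.I) / 17) = 1 := by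
    linear_combination (-18 / 68) * hI2
  have hu := norm_sub_conj_sub_sqrt_pi_le hW (b * 45 / 68) (y := b * 75 / 68) (by linarith)
  have hv := norm_sub_conj_le hW (b * 125 / 68) (y := b * 27 / 68) (by linarith)
  rw [abs_of_pos (by positivity)] at hu
  have hup : (b : ℂ) * ((5 + 3 * Complex.I) / 4 - (10 - 6 * Complex.I) / 17) =
      (b * 45 / 68 : ℝ) + (b * 75 / 68 : ℝ) * Complex.I := by push_cast; ring
  have hun : (b : ℂ) * ((5 - 3 * Complex.I) / 4 - (10 + 6 * Complex.I) / 17) =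
      (b * 45 / 68 : ℝ) - (b * 75 / 68 : ℝ) * Complex.I := by push_cast; ring
  have hvp : (b : ℂ) * ((5 + 3 * Complex.I) / 4 + (10 - 6 * Complex.I) / 17) =
      (b * 125 / 68 : ℝ) + (b * 27 / 68 : ℝ) * Complex.I := by push_cast; ring
  have hvn : (b : ℂ) * ((5 - 3 * Complex.I) / 4 + (10 + 6 * Complex.I) / 17) =
      (b * 125 / 68 : ℝ) - (b * 27 / 68 : ℝ) * Complex.I := by push_cast; ring
  rw [integral_sqrt_mul_exp hW hb0, saddlePrimitive, saddlePrimitive,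
    inv_eq_of_mul_eq_one_right hpos, inv_eq_of_mul_eq_one_right hneg, hup, hun, hvp, hvn]
  generalize W ((b * 45 / 68 : ℝ) + (b * 75 / 68 : ℝ) * Complex.I) = W₁ at *
  generalize W ((b * 45 / 68 : ℝ) - (b * 75 / 68 : ℝ) * Complex.I) = W₂ at *
  generalize W ((b * 125 / 68 : ℝ) + (b * 27 / 68 : ℝ) * Complex.I) = W₃ at *
  generalize W ((b * 125 / 68 : ℝ) - (b * 27 / 68 : ℝ) * Complex.I) = W₄ at *
  have hexp : ∀ c : ℝ, c ≤ 7 / 5 → Real.exp (c * b ^ 2) ≤ Real.exp (7 / 5 * b ^ 2) := by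
    intro c hc; gcongr
  have hs : ∀ ε : ℝ, ε ^ 2 = 1 → ‖(5 + ε * 3 * Complex.I) / 4 * Complex.exp
      (b ^ 2 * (((5 + ε * 3 * Complex.I) / 4) ^ 2 + ((10 - ε * 6 * Complex.I) / 17) ^ 2))‖ ≤
      3 / 2 * Real.exp (7 / 5 * b ^ 2) := by
    intro ε hε
    rw [norm_mul]
    refine mul_le_mul ?_ ?_ (norm_nonneg _) (by norm_num)
    · rw [Complex.norm_def, Real.sqrt_le_left (by norm_num)]
      have : (5 + ε * 3 * Complex.I) / 4 = (5 / 4 : ℝ) + (ε * 3 / 4 : ℝ) * Complex.I := by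
        push_cast; ring
      rw [this, Complex.normSq_add_mul_I]
      nlinarith
    · have : (b : ℂ) ^ 2 * (((5 + ε * 3 * Complex.I) / 4) ^ 2 + ((10 - ε * 6 * Complex.I) / 17) ^ 2) =
          (b ^ 2 * ((25 - 9 * ε ^ 2) / 16 + (100 - 36 * ε ^ 2) / 289) : ℝ) +
          (b ^ 2 * (30 * ε / 16 - 120 * ε / 289) : ℝ) * Complex.I := by
        push_cast
        linear_combination (b ^ 2 * (9 * ε ^ 2 / 16 + 36 * ε ^ 2 / 289) : ℂ) * hI2
      rw [Complex.norm_exp, this, Complex.add_re, Complex.ofReal_re, Complex.re_ofReal_mul,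
        Complex.I_re, hε, show b ^ 2 * ((25 - 9 * 1) / 16 + (100 - 36 * 1) / 289) +
          b ^ 2 * (30 * ε / 16 - 120 * ε / 289) * 0 = 353 / 289 * b ^ 2 by ring]
      exact hexp (353 / 289) (by norm_num)
  have hs1 := hs 1 (by norm_num)
  have hs2 := hs (-1) (by norm_num)
  have hkey : ∀ A B : ℂ, ∀ D E P Q : ℝ,
      (A + D * P * W₁ - E * Q * W₃ - (B + D * P * W₂ - E * Q * W₄)) / (Complex.I * b ^ 2) -
        ((D / b ^ 2 * √π * P : ℝ) : ℂ) =
      (A - B + (D * P : ℝ) * (W₁ - W₂ - Complex.I * √π) - (E * Q : ℝ) * (W₃ - W₄)) /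
        (Complex.I * b ^ 2) := by
    intro A B D E P Q
    push_cast
    field_simp
    ring
  simp only [Complex.ofReal_neg, Complex.ofReal_one, neg_mul, one_mul, ← sub_eq_add_neg,
    sub_neg_eq_add] at hs1 hs2
  generalize (5 + 3 * Complex.I) / 4 * Complex.exp (b ^ 2 * (((5 + 3 * Complex.I) / 4) ^ 2 +
    ((10 - 6 * Complex.I) / 17) ^ 2)) = A at *
  generalize (5 - 3 * Complex.I) / 4 * Complex.exp (b ^ 2 * (((5 - 3 * Complex.I) / 4) ^ 2 +
    ((10 + 6 * Complex.I) / 17) ^ 2)) = B at *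
  have hD0 : 0 ≤ b - 1 / (2 * b) := by
    rw [sub_nonneg, div_le_iff₀ (by positivity)]; nlinarith
  have hD1 : b - 1 / (2 * b) ≤ b := by
    have : 0 < 1 / (2 * b) := by positivity
    linarith
  have hE1 : b + 1 / (2 * b) ≤ b + 1 := by
    have : 1 / (2 * b) ≤ 1 := by rw [div_le_one (by positivity)]; linarith
    linarith
  have hE0 : 0 ≤ b + 1 / (2 * b) := by positivity
  rw [show (b : ℂ) - 1 / (2 * b) = ((b - 1 / (2 * b) : ℝ) : ℂ) by push_cast; rfl,
    show (b : ℂ) + 1 / (2 * b) = ((b + 1 / (2 * b) : ℝ) : ℂ) by push_cast; rfl,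
    show Complex.exp (2 * (b : ℂ) ^ 2) = (Real.exp (2 * b ^ 2) : ℝ) by push_cast; rfl,
    show Complex.exp (-(2 * (b : ℂ) ^ 2)) = (Real.exp (-(2 * b ^ 2)) : ℝ) by push_cast; rfl]
  generalize b - 1 / (2 * b) = D at *
  generalize b + 1 / (2 * b) = E at *
  have hP : Real.exp (2 * b ^ 2) * Real.exp ((b * 45 / 68) ^ 2 - (b * 75 / 68) ^ 2) ≤
      Real.exp (7 / 5 * b ^ 2) := by
    rw [← Real.exp_add, show 2 * b ^ 2 + ((b * 45 / 68) ^ 2 - (b * 75 / 68) ^ 2) =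
      353 / 289 * b ^ 2 by ring]
    exact hexp _ (by norm_num)
  have hQ : Real.exp (-(2 * b ^ 2)) * Real.exp ((b * 125 / 68) ^ 2) ≤
      Real.exp (7 / 5 * b ^ 2) := by
    rw [← Real.exp_add, show -(2 * b ^ 2) + (b * 125 / 68) ^ 2 = 6377 / 4624 * b ^ 2 by ring]
    exact hexp _ (by norm_num)
  rw [hkey, norm_div, norm_mul, Complex.norm_I, one_mul, norm_pow, Complex.norm_real,
    Real.norm_of_nonneg hb0.le, div_le_iff₀ (by positivity)]
  have hZ := Real.exp_pos (7 / 5 * b ^ 2)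
  have hP0 := Real.exp_pos (2 * b ^ 2)
  have hQ0 := Real.exp_pos (-(2 * b ^ 2))
  have hP'0 := Real.exp_pos ((b * 45 / 68) ^ 2 - (b * 75 / 68) ^ 2)
  have hQ'0 := Real.exp_pos ((b * 125 / 68) ^ 2)
  generalize Real.exp (7 / 5 * b ^ 2) = Z at *
  generalize Real.exp (2 * b ^ 2) = P at *
  generalize Real.exp (-(2 * b ^ 2)) = Q at *
  generalize Real.exp ((b * 45 / 68) ^ 2 - (b * 75 / 68) ^ 2) = P' at *
  generalize Real.exp ((b * 125 / 68) ^ 2) = Q' at *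
  have t1 : ‖((D * P : ℝ) : ℂ) * (W₁ - W₂ - Complex.I * √π)‖ ≤
      b * (2 * (b * 45 / 68 + 1)) * Z := by
    rw [norm_mul, Complex.norm_real, Real.norm_of_nonneg (by positivity)]
    calc D * P * ‖W₁ - W₂ - Complex.I * √π‖
        ≤ D * P * (2 * (b * 45 / 68 + 1) * P') := by gcongr
      _ = D * (2 * (b * 45 / 68 + 1)) * (P * P') := by ring
      _ ≤ b * (2 * (b * 45 / 68 + 1)) * Z := by gcongr
  have t2 : ‖((E * Q : ℝ) : ℂ) * (W₃ - W₄)‖ ≤ (b + 1) * (2 * (b * 27 / 68)) * Z := by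
    rw [norm_mul, Complex.norm_real, Real.norm_of_nonneg (by positivity)]
    calc E * Q * ‖W₃ - W₄‖ ≤ E * Q * (2 * (b * 27 / 68) * Q') := by gcongr
      _ = E * (2 * (b * 27 / 68)) * (Q * Q') := by ring
      _ ≤ _ := by gcongr
  have t3 : ‖A - B + ((D * P : ℝ) : ℂ) * (W₁ - W₂ - Complex.I * √π) -
      ((E * Q : ℝ) : ℂ) * (W₃ - W₄)‖ ≤ 3 * Z + b * (2 * (b * 45 / 68 + 1)) * Z +
        (b + 1) * (2 * (b * 27 / 68)) * Z := by
    refine (norm_sub_le _ _).trans (add_le_add ((norm_add_le _ _).trans (add_le_add ?_ t1)) t2)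
    exact (norm_sub_le _ _).trans (by linarith)
  refine t3.trans ?_
  have : 3 + b * (2 * (b * 45 / 68 + 1)) + (b + 1) * (2 * (b * 27 / 68)) ≤ 8 * b ^ 2 := by
    nlinarith
  nlinarith

/-- The approximation to `overGen (exp (-t))` for small `t` given by the modular transformation. -/
noncomputable def overGenMain (t : ℂ) : ℂ :=
  Complex.sqrt t / (2 * √π) * Complex.exp (π ^ 2 / (4 * t))

theorem re_inv_add_mul_I (c y : ℝ) : ((c + y * Complex.I : ℂ)⁻¹).re = c / (c ^ 2 + y ^ 2) := by
  rw [Complex.inv_re, Complex.normSq_add_mul_I]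
  simp

theorem norm_overGenMain_le {c y : ℝ} (hc : 0 < c) (hcy : c ^ 2 + y ^ 2 ≤ 1) :
    ‖overGenMain (c + y * Complex.I)‖ ≤ Real.exp (π ^ 2 / (4 * c)) / 2 := by
  have ht0 : (c + y * Complex.I : ℂ) ≠ 0 := fun h => hc.ne' (by simpa using congrArg Complex.re h)
  have hs : ‖Complex.sqrt (c + y * Complex.I)‖ ≤ 1 := by
    have h1 : ‖(c + y * Complex.I : ℂ)‖ ≤ 1 := by
      rw [Complex.norm_def, Complex.normSq_add_mul_I]
      exact Real.sqrt_le_one.mpr hcy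
    rw [← sqrt_sq ht0, norm_pow] at h1
    exact (pow_le_one_iff_of_nonneg (norm_nonneg _) two_ne_zero).mp h1
  have hp : 1 ≤ √π := Real.one_le_sqrt.mpr (by linarith [Real.pi_gt_three])
  rw [overGenMain, norm_mul, norm_div, norm_mul, Complex.norm_real, Real.norm_of_nonneg (by positivity),
    Complex.norm_two, Complex.norm_exp,
    show (π : ℂ) ^ 2 / (4 * (c + y * Complex.I)) = ((π ^ 2 / 4 : ℝ) : ℂ) * (c + y * Complex.I)⁻¹ by
      push_cast; rw [← div_div, div_eq_mul_inv],
    Complex.re_ofReal_mul, re_inv_add_mul_I]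
  have he : π ^ 2 / 4 * (c / (c ^ 2 + y ^ 2)) ≤ π ^ 2 / (4 * c) := by
    rw [← div_div, div_eq_mul_one_div _ c]
    refine mul_le_mul_of_nonneg_left ?_ (by positivity)
    rw [div_le_div_iff₀ (by positivity) hc]
    nlinarith [sq_nonneg y]
  calc ‖Complex.sqrt (c + y * Complex.I)‖ / (2 * √π) * Real.exp (π ^ 2 / 4 * (c / (c ^ 2 + y ^ 2)))
      ≤ 1 / (2 * 1) * Real.exp (π ^ 2 / (4 * c)) := by gcongr
    _ = _ := by ring

theorem norm_overGen_sub_overGenMain_le {c y : ℝ} (hc : 0 < c) (hc1 : c ≤ 1 / 4)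
    (hy : |y| ≤ 15 / 8 * c) :
    ‖overGen (Complex.exp (-(c + y * Complex.I))) - overGenMain (c + y * Complex.I)‖ ≤
      2 * Real.exp (-(π / c)) * Real.exp (π ^ 2 / (4 * c)) := by
  have hre : (c + y * Complex.I : ℂ).re = c := by simp
  have hy2 : y ^ 2 ≤ 225 / 64 * c ^ 2 := by
    have := sq_le_sq' (by linarith [abs_nonneg y]) hy
    rw [sq_abs] at this
    nlinarith
  have hw : ‖Complex.exp (-(2 * π ^ 2 / (c + y * Complex.I)))‖ ≤ Real.exp (-(π / c)) := by
    rw [Complex.norm_exp, show -(2 * (π : ℂ) ^ 2 / (c + y * Complex.I)) =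
      ((-(2 * π ^ 2) : ℝ) : ℂ) * (c + y * Complex.I)⁻¹ by
        push_cast; rw [div_eq_mul_inv, neg_mul], Complex.re_ofReal_mul, re_inv_add_mul_I]
    gcongr
    have : 64 / 289 * (1 / c) ≤ c / (c ^ 2 + y ^ 2) := by
      rw [mul_one_div, div_div, div_le_div_iff₀ (by positivity) (by positivity)]
      nlinarith
    have h2 : 64 / 289 * (2 * π) * (π / c) ≤ 2 * π ^ 2 * (c / (c ^ 2 + y ^ 2)) := by
      calc 64 / 289 * (2 * π) * (π / c) = 2 * π ^ 2 * (64 / 289 * (1 / c)) := by ring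
        _ ≤ _ := by gcongr
    have h3 : 0 < π / c := div_pos Real.pi_pos hc
    nlinarith [Real.pi_gt_three]
  have hsmall : Real.exp (-(π / c)) ≤ 1 / 16 := by
    have h1 : 12 ≤ π / c := by
      rw [le_div_iff₀ hc]; linarith [Real.pi_gt_three]
    have h2 := Real.add_one_le_exp (π / c / 2)
    have h3 : Real.exp (π / c) = Real.exp (π / c / 2) ^ 2 := by
      rw [← Real.exp_nat_mul]; push_cast; ring_nf
    rw [Real.exp_neg, h3, inv_le_comm₀ (by positivity) (by norm_num)]
    nlinarith
  have hδ := norm_eulerProd_div_sub_one_le (hw.trans hsmall)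
  have hF := norm_overGenMain_le (y := y) hc (by nlinarith)
  rw [overGen_exp_neg (by rw [hre]; exact hc), ← overGenMain, ← mul_sub_one, norm_mul]
  calc _ ≤ Real.exp (π ^ 2 / (4 * c)) / 2 * (4 * Real.exp (-(π / c))) := by
        gcongr
        exact hδ.trans (by gcongr)
    _ = _ := by ring

theorem norm_overGen_exp_neg_le {c : ℝ} (hc : 0 < c) (hc1 : c ≤ 1 / 4) :
    ‖overGen (Complex.exp (-c))‖ ≤ Real.exp (π ^ 2 / (4 * c)) := by
  have h1 := norm_overGen_sub_overGenMain_le (y := 0) hc hc1 (by simp; positivity)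
  have h2 := norm_overGenMain_le (y := 0) hc (by nlinarith)
  simp only [Complex.ofReal_zero, zero_mul, add_zero] at h1 h2
  have hsmall : Real.exp (-(π / c)) ≤ 1 / 4 := by
    have h1 : 12 ≤ π / c := by
      rw [le_div_iff₀ hc]; linarith [Real.pi_gt_three]
    rw [Real.exp_neg, inv_le_comm₀ (by positivity) (by norm_num)]
    linarith [Real.add_one_le_exp (π / c)]
  have h3 := norm_le_norm_sub_add (overGen (Complex.exp (-c))) (overGenMain c)
  nlinarith [Real.exp_pos (π ^ 2 / (4 * c))]

theorem norm_overGen_exp_neg_add_mul_I_le {c y : ℝ} (hc : 0 < c) (hc1 : c ≤ 1 / 10)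
    (hy : 15 / 8 * c ≤ |y|) (hyπ : |y| ≤ π) :
    ‖overGen (Complex.exp (-(c + y * Complex.I)))‖ ≤
      Real.exp (-(π / (4 * c))) * Real.exp (π ^ 2 / (4 * c)) := by
  have hnorm := norm_exp_neg_add_mul_I c y
  have hr1 : Real.exp (-c) < 1 := by rw [Real.exp_lt_one_iff]; linarith
  have hrc := Real.one_sub_le_exp_neg c
  have hle := norm_overGen_le (z := Complex.exp (-(c + y * Complex.I))) (by rw [hnorm]; exact hr1)
  rw [hnorm, Complex.ofReal_exp, Complex.ofReal_neg] at hle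
  have hcos := Real.cos_le_one_sub_mul_cos_sq hyπ
  have hre : (Complex.exp (-(c + y * Complex.I))).re = Real.exp (-c) * Real.cos y := by
    rw [Complex.exp_re]; simp
  have him : (Complex.exp (-(c + y * Complex.I))).im = -(Real.exp (-c) * Real.sin y) := by
    rw [Complex.exp_im]; simp
  set r := Real.exp (-c) with hr
  have hΔ : π / (8 * c) ≤ r / (1 - r) -
      (Complex.exp (-(c + y * Complex.I)) / (1 - Complex.exp (-(c + y * Complex.I)))).re := by
    rw [Complex.div_re, Complex.normSq_apply, Complex.sub_re, Complex.sub_im, hre, him]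
    simp only [Complex.one_re, Complex.one_im]
    have hsc := Real.sin_sq_add_cos_sq y
    obtain ⟨u, hu⟩ : ∃ u, u = 1 - r := ⟨_, rfl⟩
    obtain ⟨k, hk⟩ : ∃ k, k = r * (1 - Real.cos y) := ⟨_, rfl⟩
    have hu0 : 0 < u := by linarith
    have huc : u ≤ c := by linarith
    have hr0 : 0 < r := Real.exp_pos _
    have hr9 : 9 / 10 ≤ r := by linarith
    have hku : 3 / 5 * u ^ 2 ≤ k := by
      have hy2 : 225 / 64 * u ^ 2 ≤ y ^ 2 := by
        rw [← sq_abs y]; nlinarith [abs_nonneg y]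
      have hπ2 : 1 / 5 ≤ 2 / π ^ 2 := by
        rw [div_le_div_iff₀ (by norm_num) (by positivity)]
        nlinarith [Real.pi_lt_d2, Real.pi_pos]
      have h1 : 1 / 5 * (225 / 64 * u ^ 2) ≤ 1 - Real.cos y := by
        calc 1 / 5 * (225 / 64 * u ^ 2) ≤ 2 / π ^ 2 * y ^ 2 := by gcongr
          _ ≤ _ := by linarith
      have h2 : 9 / 10 * (1 / 5 * (225 / 64 * u ^ 2)) ≤ r * (1 - Real.cos y) := by gcongr
      rw [hk]
      nlinarith [sq_nonneg u]
    have hk0 : 0 < k := lt_of_lt_of_le (by positivity) hku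
    have hden : (1 - r * Real.cos y) * (1 - r * Real.cos y) +
        (0 - -(r * Real.sin y)) * (0 - -(r * Real.sin y)) = u ^ 2 + 2 * k := by
      rw [hu, hk]; linear_combination r ^ 2 * hsc
    have hnum : r * Real.cos y * (1 - r * Real.cos y) = r * u - k + r ^ 2 * Real.sin y ^ 2 := by
      rw [hu, hk]; linear_combination -r ^ 2 * hsc
    rw [hden, ← add_div, hnum, ← hu,
      show r * u - k + r ^ 2 * Real.sin y ^ 2 + -(r * Real.sin y) * (0 - -(r * Real.sin y)) =
        r * u - k by ring]
    rw [div_sub_div _ _ hu0.ne' (by positivity), div_le_div_iff₀ (by positivity) (by positivity)]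
    have h1 : π * (u ^ 2 + 2 * k) ≤ 8 * k * (2 * r + u) := by
      have := Real.pi_lt_d2
      calc π * (u ^ 2 + 2 * k) ≤ 3.15 * (u ^ 2 + 2 * k) := by gcongr
        _ ≤ 8 * k * (2 * r + u) := by nlinarith
    calc π * (u * (u ^ 2 + 2 * k)) = π * (u ^ 2 + 2 * k) * u := by ring
      _ ≤ 8 * k * (2 * r + u) * c := by gcongr
      _ = _ := by ring
  calc _ ≤ _ := hle
    _ ≤ Real.exp (π ^ 2 / (4 * c)) * Real.exp (-(π / (4 * c))) := by
        gcongr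
        · exact norm_overGen_exp_neg_le hc (by linarith)
        · have : π / (4 * c) = 2 * (π / (8 * c)) := by field_simp; norm_num
          linarith
    _ = _ := mul_comm _ _

theorem sqrt_ofReal_mul {c : ℝ} (hc : 0 < c) {z : ℂ} (hz : z ≠ 0) :
    Complex.sqrt (c * z) = √c * Complex.sqrt z := by
  have hc' : (c : ℂ) ≠ 0 := by exact_mod_cast hc.ne'
  rw [sqrt_eq_exp (mul_ne_zero hc' hz), sqrt_eq_exp hz, Complex.log_ofReal_mul hc hz, add_div,
    Complex.exp_add, Real.sqrt_eq_rpow, Real.rpow_def_of_pos hc]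
  push_cast
  ring_nf

theorem integral_overGenMain_mul_exp {b c x : ℝ} (hc : 0 < c)
    (hbc : π ^ 2 / (4 * c) = b ^ 2) (hx : x * c = b ^ 2) :
    ∫ y in (-(15 / 8 * c))..(15 / 8 * c),
        overGenMain (c + y * Complex.I) * Complex.exp (x * (c + y * Complex.I)) =
      (c * √c / (2 * √π) : ℝ) *
        ∫ y in (-(15 / 8) : ℝ)..(15 / 8), Complex.sqrt (1 + y * Complex.I) *
          Complex.exp (b ^ 2 * ((1 + y * Complex.I) + (1 + y * Complex.I)⁻¹)) := by
  have h := intervalIntegral.smul_integral_comp_mul_left (a := -(15 / 8)) (b := 15 / 8)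
    (fun y : ℝ => overGenMain (c + y * Complex.I) * Complex.exp (x * (c + y * Complex.I))) c
  rw [show c * (15 / 8) = 15 / 8 * c by ring, show c * -(15 / 8) = -(15 / 8 * c) by ring] at h
  have hbc' : (π : ℂ) ^ 2 / (4 * c) = b ^ 2 := by exact_mod_cast hbc
  have hx' : (x : ℂ) * c = b ^ 2 := by exact_mod_cast hx
  rw [← h, Complex.real_smul]
  have hpt : ∀ y : ℝ, overGenMain (c + (c * y : ℝ) * Complex.I) *
      Complex.exp (x * (c + (c * y : ℝ) * Complex.I)) = (√c / (2 * √π) : ℝ) *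
        (Complex.sqrt (1 + y * Complex.I) *
          Complex.exp (b ^ 2 * ((1 + y * Complex.I) + (1 + y * Complex.I)⁻¹))) := by
    intro y
    have hz : (1 + y * Complex.I : ℂ) ≠ 0 := fun h =>
      (one_ne_zero : (1 : ℝ) ≠ 0) (by simpa using congrArg Complex.re h)
    rw [show (c + (c * y : ℝ) * Complex.I : ℂ) = c * (1 + y * Complex.I) by push_cast; ring,
      overGenMain, sqrt_ofReal_mul hc hz, mul_add ((b : ℂ) ^ 2), Complex.exp_add, ← mul_assoc (x : ℂ),
      hx', ← mul_assoc (4 : ℂ), ← div_div (_ ^ 2 : ℂ), hbc', ← div_eq_mul_inv]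
    push_cast
    ring
  simp only [hpt]
  rw [intervalIntegral.integral_const_mul, ← mul_assoc]
  push_cast
  ring

theorem abs_pbar_sub_le {n : ℕ} {M : ℝ} (hM : 20 ≤ M) (hn : (n : ℝ) = M ^ 2) :
    |(pbar n : ℝ) - 1 / (8 * M ^ 2) * (1 - 1 / (π * M)) * Real.exp (π * M)| ≤
      4 * Real.exp (π * M - M / 2) := by
  have hM0 : 0 < M := by linarith
  have hπ3 := Real.pi_gt_three
  have hπ4 := Real.pi_lt_d2
  have hπ := Real.pi_pos
  obtain ⟨c, hcdef⟩ : ∃ c, c = π / (2 * M) := ⟨_, rfl⟩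
  have hc : 0 < c := by rw [hcdef]; positivity
  have hc1 : c ≤ 1 / 10 := by
    rw [hcdef, div_le_div_iff₀ (by positivity) (by norm_num)]; linarith
  have hc2 : π / c = 2 * M := by rw [hcdef]; field_simp
  have hc3 : π / (4 * c) = M / 2 := by rw [hcdef]; field_simp; norm_num
  have hc4 : π ^ 2 / (4 * c) = π * M / 2 := by rw [hcdef]; field_simp; norm_num
  have hnc : (n : ℝ) * c = π * M / 2 := by rw [hn, hcdef]; field_simp
  obtain ⟨b, hbdef⟩ : ∃ b, b = √(π * M / 2) := ⟨_, rfl⟩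
  have hb2 : b ^ 2 = π * M / 2 := by rw [hbdef, Real.sq_sqrt (by positivity)]
  have hb : 2 ≤ b := by
    rw [hbdef]; exact Real.le_sqrt_of_sq_le (by nlinarith)
  have hYπ : 15 / 8 * c ≤ π := by linarith
  set f : ℝ → ℂ := fun y => overGen (Complex.exp (-(c + y * Complex.I))) *
    Complex.exp (n * (c + y * Complex.I)) with hf
  set g : ℝ → ℂ := fun y => overGenMain (c + y * Complex.I) *
    Complex.exp ((n : ℝ) * (c + y * Complex.I)) with hg
  have hfc : Continuous f := (continuous_overGen_exp hc).mul (by fun_prop)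
  have hre : ∀ y : ℝ, ‖Complex.exp (n * (c + y * Complex.I))‖ = Real.exp (π * M / 2) := by
    intro y
    rw [Complex.norm_exp, ← hnc, ← Complex.ofReal_natCast, Complex.re_ofReal_mul]
    simp
  have hcut : Real.exp (-(M / 2)) * Real.exp (π * M / 2) * Real.exp (π * M / 2) =
      Real.exp (π * M - M / 2) := by
    rw [← Real.exp_add, ← Real.exp_add]; ring_nf
  have hminor : ∀ y : ℝ, 15 / 8 * c ≤ |y| → |y| ≤ π → ‖f y‖ ≤ Real.exp (π * M - M / 2) := by
    intro y h1 h2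
    have := norm_overGen_exp_neg_add_mul_I_le hc hc1 h1 h2
    rw [hc3, hc4] at this
    rw [hf, norm_mul, hre, ← hcut]
    gcongr
  have hmajor : ∀ y : ℝ, |y| ≤ 15 / 8 * c → ‖f y - g y‖ ≤ 2 * Real.exp (π * M - M / 2) := by
    intro y h1
    have := norm_overGen_sub_overGenMain_le hc (by linarith) h1
    rw [hc2, hc4] at this
    rw [hf, hg]
    simp only [Complex.ofReal_natCast]
    rw [← sub_mul, norm_mul, hre, ← hcut]
    have h3 : Real.exp (-(2 * M)) ≤ Real.exp (-(M / 2)) := by gcongr; linarith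
    calc _ ≤ 2 * Real.exp (-(2 * M)) * Real.exp (π * M / 2) * Real.exp (π * M / 2) := by gcongr
      _ ≤ 2 * Real.exp (-(M / 2)) * Real.exp (π * M / 2) * Real.exp (π * M / 2) := by gcongr
      _ = _ := by ring
  have hgc : Continuous g := by
    have h1 : Continuous fun y : ℝ => (c + y * Complex.I : ℂ) := by fun_prop
    have hslit : ∀ y : ℝ, (c + y * Complex.I : ℂ) ∈ Complex.slitPlane := fun y =>
      Or.inl (by simpa using hc)
    have h2 : Continuous fun y : ℝ => Complex.sqrt (c + y * Complex.I) :=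
      Complex.continuousOn_sqrt.comp_continuous h1 hslit
    have h3 : Continuous fun y : ℝ => (π : ℂ) ^ 2 / (4 * (c + y * Complex.I)) :=
      continuous_const.div (by fun_prop) fun y =>
        mul_ne_zero (by norm_num) (Complex.slitPlane_ne_zero (hslit y))
    exact ((h2.div_const _).mul h3.cexp).mul (by fun_prop)
  have hI := pbar_eq_integral n hc
  have hsplit : ∫ y in (-π)..π, f y = (∫ y in (-π)..(-(15 / 8 * c)), f y) +
      ((∫ y in (-(15 / 8 * c))..(15 / 8 * c), (f y - g y)) +
        ∫ y in (-(15 / 8 * c))..(15 / 8 * c), g y) + ∫ y in (15 / 8 * c)..π, f y := by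
    have hadd : (∫ y in (-(15 / 8 * c))..(15 / 8 * c), (f y - g y)) +
        ∫ y in (-(15 / 8 * c))..(15 / 8 * c), g y = ∫ y in (-(15 / 8 * c))..(15 / 8 * c), f y := by
      rw [intervalIntegral.integral_sub (hfc.intervalIntegrable _ _)
        (hgc.intervalIntegrable _ _), sub_add_cancel]
    rw [hadd, intervalIntegral.integral_add_adjacent_intervals (hfc.intervalIntegrable _ _)
        (hfc.intervalIntegrable _ _),
      intervalIntegral.integral_add_adjacent_intervals (hfc.intervalIntegrable _ _)
        (hfc.intervalIntegrable _ _)]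
  have hE := Real.exp_pos (π * M - M / 2)
  set E := Real.exp (π * M - M / 2) with hEdef
  have i1 : ‖∫ y in (-π)..(-(15 / 8 * c)), f y‖ ≤ E * π := by
    refine (intervalIntegral.norm_integral_le_of_norm_le_const fun y hy => ?_).trans
      (mul_le_mul_of_nonneg_left (b := |-(15 / 8 * c) - -π|) ?_ hE.le)
    · rw [Set.uIoc_of_le (by linarith)] at hy
      have : |y| = -y := abs_of_neg (by linarith [hy.2])
      exact hminor y (by linarith [hy.2]) (by linarith [hy.1])
    · rw [abs_of_nonneg] <;> linarith
  have i2 : ‖∫ y in (15 / 8 * c)..π, f y‖ ≤ E * π := by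
    refine (intervalIntegral.norm_integral_le_of_norm_le_const fun y hy => ?_).trans
      (mul_le_mul_of_nonneg_left (b := |π - 15 / 8 * c|) ?_ hE.le)
    · rw [Set.uIoc_of_le (by linarith)] at hy
      have : |y| = y := abs_of_pos (by linarith [hy.1])
      exact hminor y (by linarith [hy.1]) (by linarith [hy.2])
    · rw [abs_of_nonneg] <;> linarith
  have i3 : ‖∫ y in (-(15 / 8 * c))..(15 / 8 * c), (f y - g y)‖ ≤ 2 * E * π := by
    refine (intervalIntegral.norm_integral_le_of_norm_le_const fun y hy => ?_).trans
      (mul_le_mul_of_nonneg_left (b := |15 / 8 * c - -(15 / 8 * c)|) ?_ (by positivity))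
    · rw [Set.uIoc_of_le (by linarith)] at hy
      exact hmajor y (abs_le.mpr ⟨hy.1.le, hy.2⟩)
    · rw [abs_of_nonneg] <;> linarith
  have i4 : ‖(∫ y in (-(15 / 8 * c))..(15 / 8 * c), g y) -
      (2 * π * (1 / (8 * M ^ 2) * (1 - 1 / (π * M)) * Real.exp (π * M)) : ℝ)‖ ≤ E * π := by
    have hJ := norm_integral_sqrt_mul_exp_sub_le hb
    rw [hg, integral_overGenMain_mul_exp hc (hc4.trans hb2.symm) (hnc.trans hb2.symm)]
    have hval : 2 * π * (1 / (8 * M ^ 2) * (1 - 1 / (π * M)) * Real.exp (π * M)) =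
        c * √c / (2 * √π) * ((b - 1 / (2 * b)) / b ^ 2 * √π * Real.exp (2 * b ^ 2)) := by
      have hs : √c = b / M := by
        rw [← Real.sqrt_sq (by positivity : 0 ≤ b / M), div_pow, hb2, hcdef]
        congr 1
        field_simp
      have h1 : (b - 1 / (2 * b)) / b ^ 2 = (1 - 1 / (π * M)) / b := by
        rw [show π * M = 2 * b ^ 2 by linarith]
        field_simp
      rw [hs, h1, show 2 * b ^ 2 = π * M by linarith, hcdef]
      field_simp
      norm_num
    rw [hval, Complex.ofReal_mul, ← mul_sub, norm_mul, Complex.norm_real,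
      Real.norm_of_nonneg (by positivity)]
    have h2 : Real.exp (7 / 5 * b ^ 2) ≤ E := by
      rw [hEdef, hb2]
      gcongr
      nlinarith
    have h3 : c * √c / (2 * √π) * 8 ≤ π := by
      have h4 : √c ≤ 1 := Real.sqrt_le_one.mpr (by linarith)
      have h5 : 1 ≤ √π := Real.one_le_sqrt.mpr (by linarith)
      have h6 : c * √c / (2 * √π) ≤ 1 / 10 * 1 / (2 * 1) := by gcongr
      linarith
    calc _ ≤ c * √c / (2 * √π) * (8 * E) := by
          gcongr
          exact hJ.trans (by gcongr)
      _ = c * √c / (2 * √π) * 8 * E := by ring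
      _ ≤ π * E := by gcongr
      _ = E * π := mul_comm _ _
  have hπc : (π : ℂ) ≠ 0 := by exact_mod_cast hπ.ne'
  have htot : (((pbar n : ℝ) - 1 / (8 * M ^ 2) * (1 - 1 / (π * M)) * Real.exp (π * M) : ℝ) : ℂ) =
      (1 / (2 * π) : ℝ) * ((∫ y in (-π)..(-(15 / 8 * c)), f y) +
      ((∫ y in (-(15 / 8 * c))..(15 / 8 * c), (f y - g y)) +
        ((∫ y in (-(15 / 8 * c))..(15 / 8 * c), g y) -
          (2 * π * (1 / (8 * M ^ 2) * (1 - 1 / (π * M)) * Real.exp (π * M)) : ℝ))) +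
        ∫ y in (15 / 8 * c)..π, f y) := by
    set R := 1 / (8 * M ^ 2) * (1 - 1 / (π * M)) * Real.exp (π * M)
    rw [Complex.ofReal_sub, Complex.ofReal_natCast, hI, hsplit]
    push_cast
    field_simp
    ring
  rw [← Real.norm_eq_abs, ← Complex.norm_real, htot, norm_mul, Complex.norm_real,
    Real.norm_of_nonneg (by positivity)]
  calc _ ≤ 1 / (2 * π) * (E * π + (2 * E * π + E * π) + E * π) := by
        gcongr
        exact (norm_add₃_le).trans (by gcongr; exact (norm_add_le _ _).trans (by gcongr))
    _ = 5 / 2 * E := by field_simp; ring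
    _ ≤ 4 * E := by gcongr; norm_num

theorem pow_six_le_exp_half {M : ℝ} (hM : 74 ≤ M) : 200 * M ^ 6 ≤ Real.exp (M / 2) := by
  have h1 : M / 74 ≤ Real.exp ((M - 74) / 12) := by
    linarith [Real.add_one_le_exp ((M - 74) / 12)]
  have h2 : (M / 74) ^ 6 ≤ Real.exp ((M - 74) / 2) := by
    refine (pow_le_pow_left₀ (by linarith) h1 6).trans_eq ?_
    rw [← Real.exp_nat_mul]
    push_cast
    ring_nf
  have h3 : (200 * 74 ^ 6 : ℝ) ≤ Real.exp 37 := by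
    have h4 : (2.7 : ℝ) ^ 37 ≤ Real.exp 1 ^ 37 :=
      pow_le_pow_left₀ (by norm_num) (by linarith [Real.exp_one_gt_d9]) 37
    rw [← Real.exp_nat_mul] at h4
    norm_num at h4 ⊢
    linarith
  calc 200 * M ^ 6 = 200 * 74 ^ 6 * (M / 74) ^ 6 := by ring
    _ ≤ Real.exp 37 * Real.exp ((M - 74) / 2) := by gcongr
    _ = Real.exp (M / 2) := by rw [← Real.exp_add]; ring_nf

theorem abs_log_le_two_mul {x : ℝ} (hx : |x - 1| ≤ 1 / 2) : |Real.log x| ≤ 2 * |x - 1| := by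
  have h1 := abs_le.mp hx
  have h0 : 0 < x := by linarith
  have hu := Real.log_le_sub_one_of_pos h0
  have hl := Real.one_sub_inv_le_log_of_pos h0
  have h2 : 1 - x⁻¹ = (x - 1) / x := by field_simp
  have h3 : |(x - 1) / x| ≤ 2 * |x - 1| := by
    rw [abs_div, abs_of_pos h0, div_le_iff₀ h0]
    nlinarith [abs_nonneg (x - 1)]
  refine abs_le.mpr ⟨?_, ?_⟩
  · linarith [neg_abs_le ((x - 1) / x)]
  · linarith [le_abs_self (x - 1), abs_nonneg (x - 1)]

theorem abs_log_pbar_sub_le {n : ℕ} {M : ℝ} (hM : 74 ≤ M) (hn : (n : ℝ) = M ^ 2) :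
    0 < pbar n ∧ |Real.log (pbar n) - (π * M - Real.log 8 - Real.log n - 1 / (π * M) -
      1 / (2 * π ^ 2 * M ^ 2) - 1 / (3 * π ^ 3 * M ^ 3))| ≤ 1 / M ^ 4 := by
  have hM0 : 0 < M := by linarith
  have hπ3 := Real.pi_gt_three
  have hπ := Real.pi_pos
  have hmain := abs_pbar_sub_le (by linarith) hn
  obtain ⟨v, hv⟩ : ∃ v, v = 1 / (π * M) := ⟨_, rfl⟩
  rw [← hv] at hmain
  have hv0 : 0 < v := by rw [hv]; positivity
  have hv1 : v ≤ 1 / (3 * M) := by rw [hv]; gcongr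
  have hv2 : v ≤ 1 / 100 := hv1.trans (by
    rw [div_le_div_iff₀ (by positivity) (by norm_num)]; linarith)
  obtain ⟨m, hm⟩ : ∃ m, m = 1 / (8 * M ^ 2) * (1 - v) * Real.exp (π * M) := ⟨_, rfl⟩
  rw [← hm] at hmain
  have hm0 : 0 < m := by
    rw [hm]
    have : 0 < 1 - v := by linarith
    positivity
  have hrel : |(pbar n : ℝ) / m - 1| ≤ 1 / (4 * M ^ 4) := by
    have h1 : (pbar n : ℝ) / m - 1 = (pbar n - m) / m := by field_simp
    rw [h1, abs_div, abs_of_pos hm0, div_le_iff₀ hm0]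
    refine hmain.trans ?_
    rw [hm, Real.exp_sub, mul_div_assoc', div_le_iff₀ (Real.exp_pos _)]
    have h2 := pow_six_le_exp_half hM
    have h3 : 0 < 1 - v := by linarith
    calc 4 * Real.exp (π * M)
        ≤ 1 / (4 * M ^ 4) * (1 / (8 * M ^ 2) * (99 / 100) * Real.exp (π * M)) * (200 * M ^ 6) := by
          have : 1 / (4 * M ^ 4) * (1 / (8 * M ^ 2) * (99 / 100) * Real.exp (π * M)) *
            (200 * M ^ 6) = 200 / 32 * (99 / 100) * Real.exp (π * M) := by field_simp; norm_num
          rw [this]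
          gcongr
          norm_num
      _ ≤ _ := by
          gcongr
          linarith
  have hM4 : 1 ≤ M ^ 4 := one_le_pow₀ (by linarith)
  have hsmall : 1 / (4 * M ^ 4) ≤ 1 / 2 := by
    rw [div_le_div_iff₀ (by positivity) (by norm_num)]; linarith
  have hlog1 := abs_log_le_two_mul (hrel.trans hsmall)
  have hpos : 0 < (pbar n : ℝ) := by
    have h1 := (abs_le.mp (hrel.trans hsmall)).1
    have h2 : 0 < (pbar n : ℝ) / m := by linarith
    exact (div_pos_iff_of_pos_right hm0).mp h2
  refine ⟨by exact_mod_cast hpos, ?_⟩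
  have hlogm : Real.log m = π * M - Real.log 8 - Real.log n + Real.log (1 - v) := by
    rw [hm, Real.log_mul (mul_ne_zero (by positivity) (by linarith)) (Real.exp_ne_zero _),
      Real.log_mul (by positivity) (by linarith), Real.log_exp, one_div, Real.log_inv,
      Real.log_mul (by norm_num) (by positivity), hn]
    ring
  have hlog2 := Real.abs_log_sub_add_sum_range_le (x := v) (by rw [abs_of_pos hv0]; linarith) 3
  rw [abs_of_pos hv0] at hlog2
  have htail : v ^ (3 + 1) / (1 - v) ≤ 1 / (2 * M ^ 4) := by
    calc v ^ (3 + 1) / (1 - v) ≤ (1 / (3 * M)) ^ (3 + 1) / (1 / 2) := by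
          gcongr
          linarith
      _ = 2 / 81 / M ^ 4 := by rw [div_pow, mul_pow]; field_simp; norm_num
      _ ≤ 1 / 2 / M ^ 4 := div_le_div_of_nonneg_right (by norm_num) (by positivity)
      _ = _ := by rw [div_div]
  rw [Real.log_div hpos.ne' hm0.ne', hlogm] at hlog1
  have hpoly : 1 / (π * M) + 1 / (2 * π ^ 2 * M ^ 2) + 1 / (3 * π ^ 3 * M ^ 3) =
      v + v ^ 2 / 2 + v ^ 3 / 3 := by
    rw [hv]; field_simp
  simp only [Finset.sum_range_succ, Finset.sum_range_zero] at hlog2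
  norm_num at hlog2
  have e1 := abs_le.mp (hlog1.trans (mul_le_mul_of_nonneg_left hrel zero_le_two))
  have e2 := abs_le.mp (hlog2.trans htail)
  have e3 : 1 / M ^ 4 = 2 * (1 / (4 * M ^ 4)) + 1 / (2 * M ^ 4) := by field_simp; norm_num
  rw [abs_le]
  constructor <;> linarith [e1.1, e1.2, e2.1, e2.2]

/-- The main terms of `log (rseq α x)`, shifted by `-4 / x`. -/
noncomputable def logRseqMain (α x : ℝ) : ℝ :=
  π * x ^ (-1 / 2 : ℝ) - (Real.log 8 + 4) * x ^ (-1 : ℝ) - (α + 1) * (x ^ (-1 : ℝ) * Real.log x) -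
    1 / π * x ^ (-3 / 2 : ℝ) - 1 / (2 * π ^ 2) * x ^ (-2 : ℝ) - 1 / (3 * π ^ 3) * x ^ (-5 / 2 : ℝ)

theorem hasDerivAt_rpow_of_pos {x : ℝ} (hx : 0 < x) (p q : ℝ) (hq : q = p - 1) :
    HasDerivAt (fun x : ℝ => x ^ p) (p * x ^ q) x :=
  hq ▸ Real.hasDerivAt_rpow_const (Or.inl hx.ne')

theorem hasDerivAt_rpow_mul_log {x : ℝ} (hx : 0 < x) (p q : ℝ) (hq : q = p - 1) :
    HasDerivAt (fun x : ℝ => x ^ p * Real.log x) (p * (x ^ q * Real.log x) + x ^ q) x := by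
  refine ((hasDerivAt_rpow_of_pos hx p q hq).mul (Real.hasDerivAt_log hx.ne')).congr_deriv ?_
  rw [hq, Real.rpow_sub_one hx.ne']
  ring

theorem hasDerivAt_logRseqMain {α x : ℝ} (hx : 0 < x) :
    HasDerivAt (logRseqMain α)
      (π * (-1 / 2 * x ^ (-3 / 2 : ℝ)) - (Real.log 8 + 4) * (-1 * x ^ (-2 : ℝ)) -
        (α + 1) * (-1 * (x ^ (-2 : ℝ) * Real.log x) + x ^ (-2 : ℝ)) -
        1 / π * (-3 / 2 * x ^ (-5 / 2 : ℝ)) - 1 / (2 * π ^ 2) * (-2 * x ^ (-3 : ℝ)) -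
        1 / (3 * π ^ 3) * (-5 / 2 * x ^ (-7 / 2 : ℝ))) x := by
  have h := hasDerivAt_rpow_of_pos hx
  exact ((((((h (-1 / 2) (-3 / 2) (by norm_num)).const_mul _).sub
    ((h (-1) (-2) (by norm_num)).const_mul _)).sub
    ((hasDerivAt_rpow_mul_log hx (-1) (-2) (by norm_num)).const_mul _)).sub
    ((h (-3 / 2) (-5 / 2) (by norm_num)).const_mul _)).sub
    ((h (-2) (-3) (by norm_num)).const_mul _)).sub
    ((h (-5 / 2) (-7 / 2) (by norm_num)).const_mul _)

theorem hasDerivAt_deriv_logRseqMain {α x : ℝ} (hx : 0 < x) :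
    HasDerivAt (fun x : ℝ =>
      (π * (-1 / 2 * x ^ (-3 / 2 : ℝ)) - (Real.log 8 + 4) * (-1 * x ^ (-2 : ℝ)) -
        (α + 1) * (-1 * (x ^ (-2 : ℝ) * Real.log x) + x ^ (-2 : ℝ)) -
        1 / π * (-3 / 2 * x ^ (-5 / 2 : ℝ)) - 1 / (2 * π ^ 2) * (-2 * x ^ (-3 : ℝ)) -
        1 / (3 * π ^ 3) * (-5 / 2 * x ^ (-7 / 2 : ℝ))))
      (3 / 4 * π * x ^ (-5 / 2 : ℝ) - 2 * (Real.log 8 + 4) * x ^ (-3 : ℝ) -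
        (α + 1) * (2 * Real.log x - 3) * x ^ (-3 : ℝ) - 15 / (4 * π) * x ^ (-7 / 2 : ℝ) -
        3 / π ^ 2 * x ^ (-4 : ℝ) - 35 / (12 * π ^ 3) * x ^ (-9 / 2 : ℝ)) x := by
  have h := hasDerivAt_rpow_of_pos hx
  refine (((((((h (-3 / 2) (-5 / 2) (by norm_num)).const_mul (-1 / 2)).const_mul _).sub
    (((h (-2) (-3) (by norm_num)).const_mul (-1)).const_mul _)).sub
    ((((hasDerivAt_rpow_mul_log hx (-2) (-3) (by norm_num)).const_mul (-1)).add
      (h (-2) (-3) (by norm_num))).const_mul _)).sub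
    (((h (-5 / 2) (-7 / 2) (by norm_num)).const_mul (-3 / 2)).const_mul _)).sub
    (((h (-3) (-4) (by norm_num)).const_mul (-2)).const_mul _)).sub
    (((h (-7 / 2) (-9 / 2) (by norm_num)).const_mul (-5 / 2)).const_mul _) |>.congr_deriv ?_
  ring

theorem second_deriv_logRseqMain_nonneg {α x y : ℝ} (hα : 0 ≤ α) (hy : 8 ≤ y) (hxy : x = y ^ 4)
    (hαy : 2 * (α + 1) + Real.log 8 + 1 ≤ 3 * π / 4 * y) :
    0 ≤ 3 / 4 * π * x ^ (-5 / 2 : ℝ) - 2 * (Real.log 8 + 4) * x ^ (-3 : ℝ) -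
        (α + 1) * (2 * Real.log x - 3) * x ^ (-3 : ℝ) - 15 / (4 * π) * x ^ (-7 / 2 : ℝ) -
        3 / π ^ 2 * x ^ (-4 : ℝ) - 35 / (12 * π ^ 3) * x ^ (-9 / 2 : ℝ) := by
  have hy0 : 0 < y := by linarith
  have hπ := Real.pi_gt_three
  have hrpow : ∀ (p : ℝ) (k : ℕ), p = -(k : ℝ) / 4 → x ^ p = 1 / y ^ k := by
    intro p k hp
    rw [hxy, ← Real.rpow_natCast y 4, ← Real.rpow_mul hy0.le, one_div, ← Real.rpow_natCast y k,
      ← Real.rpow_neg hy0.le, hp]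
    congr 1
    push_cast
    ring
  have hlog2l := Real.log_two_gt_d9
  have hlog2 := Real.log_two_lt_d9
  have hlog8 : Real.log 8 = 3 * Real.log 2 := by
    rw [show (8 : ℝ) = 2 ^ 3 by norm_num, Real.log_pow]; norm_num
  have hlogx : Real.log x ≤ y + 3 / 2 := by
    have h1 : Real.log (y / 8) ≤ y / 8 - 1 := Real.log_le_sub_one_of_pos (by positivity)
    rw [Real.log_div hy0.ne' (by norm_num)] at h1
    rw [hxy, Real.log_pow]
    push_cast
    linarith
  rw [hrpow (-5 / 2) 10 (by norm_num), hrpow (-3) 12 (by norm_num), hrpow (-7 / 2) 14 (by norm_num),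
    hrpow (-4) 16 (by norm_num), hrpow (-9 / 2) 18 (by norm_num)]
  have hd : 15 / (4 * π) ≤ 2 := by rw [div_le_iff₀ (by positivity)]; linarith
  have he : 3 / π ^ 2 ≤ 2 := by rw [div_le_iff₀ (by positivity)]; nlinarith
  have hf : 35 / (12 * π ^ 3) ≤ 2 := by
    rw [div_le_iff₀ (by positivity)]
    have : (3 : ℝ) ^ 3 ≤ π ^ 3 := by gcongr
    linarith
  have hlow : ∀ {a : ℝ} (j : ℕ), a ≤ 2 → a * (1 / y ^ (12 + j)) ≤ 2 * (1 / y ^ 12) := by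
    intro a j ha
    have : 1 / y ^ (12 + j) ≤ 1 / y ^ 12 := by
      gcongr
      · linarith
      · omega
    gcongr
  have h14 := hlow 2 hd
  have h16 := hlow 4 he
  have h18 := hlow 6 hf
  norm_num only at h14 h16 h18
  have hmain : 0 ≤ 3 / 4 * π * y ^ 2 - 2 * (Real.log 8 + 4) - (α + 1) * (2 * Real.log x - 3) - 6 := by
    have h1 : (2 * (α + 1) + Real.log 8 + 1) * y ≤ 3 * π / 4 * y * y := by gcongr
    have h2 : (α + 1) * (2 * Real.log x - 3) ≤ (α + 1) * (2 * y) := by gcongr; linarith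
    nlinarith
  have h10 : 1 / y ^ 10 = y ^ 2 * (1 / y ^ 12) := by field_simp
  have := mul_nonneg hmain (by positivity : 0 ≤ 1 / y ^ 12)
  rw [h10]
  linarith

theorem convexOn_logRseqMain {α Y : ℝ} (hα : 0 ≤ α) (hY : 8 ≤ Y)
    (hαY : 2 * (α + 1) + Real.log 8 + 1 ≤ 3 * π / 4 * Y) :
    ConvexOn ℝ (Set.Ici (Y ^ 4)) (logRseqMain α) := by
  have hpos : ∀ x ∈ Set.Ici (Y ^ 4), 0 < x := fun x hx =>
    (by positivity : 0 < Y ^ 4).trans_le hx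
  refine convexOn_of_hasDerivWithinAt2_nonneg (convex_Ici _)
    (fun x hx => (hasDerivAt_logRseqMain (hpos x hx)).continuousAt.continuousWithinAt)
    (fun x hx => (hasDerivAt_logRseqMain (hpos x (interior_subset hx))).hasDerivWithinAt)
    (fun x hx => (hasDerivAt_deriv_logRseqMain (hpos x (interior_subset hx))).hasDerivWithinAt)
    (fun x hx => ?_)
  have hx' := interior_subset hx
  have hx0 := hpos x hx'
  have hYx : Y ≤ x ^ (1 / 4 : ℝ) := by
    rw [← Real.pow_rpow_inv_natCast (by linarith : 0 ≤ Y) (four_ne_zero : (4 : ℕ) ≠ 0)]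
    norm_num
    gcongr
    exact hx'
  refine second_deriv_logRseqMain_nonneg hα (hY.trans hYx) ?_ (hαY.trans (by gcongr))
  rw [← Real.rpow_natCast, ← Real.rpow_mul hx0.le]
  norm_num

theorem abs_log_rseq_sub_le {α : ℝ} {n : ℕ} (hn : 5476 ≤ n) :
    0 < rseq α n ∧ |Real.log (rseq α n) - (logRseqMain α n + 4 / n)| ≤ 1 / (n : ℝ) ^ 3 := by
  have hnR : (5476 : ℝ) ≤ n := by exact_mod_cast hn
  obtain ⟨M, hMdef⟩ : ∃ M, M = √(n : ℝ) := ⟨_, rfl⟩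
  have hM : 74 ≤ M := hMdef ▸ Real.le_sqrt_of_sq_le (by linarith)
  have hnM : (n : ℝ) = M ^ 2 := by rw [hMdef, Real.sq_sqrt (by linarith)]
  have hM0 : 0 < M := by linarith
  have hn0 : (0 : ℝ) < n := by linarith
  obtain ⟨hp, hlog⟩ := abs_log_pbar_sub_le hM hnM
  have hpR : (0 : ℝ) < pbar n := by exact_mod_cast hp
  have hα0 : 0 < (n : ℝ) ^ α := Real.rpow_pos_of_pos hn0 _
  refine ⟨Real.rpow_pos_of_pos (div_pos hpR hα0) _, ?_⟩
  have hrpow : ∀ (p : ℝ) (k : ℕ), p = -(k : ℝ) / 2 → (n : ℝ) ^ p = 1 / M ^ k := by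
    intro p k hp
    rw [hnM, ← Real.rpow_natCast M 2, ← Real.rpow_mul hM0.le, one_div, ← Real.rpow_natCast M k,
      ← Real.rpow_neg hM0.le, hp]
    congr 1
    push_cast
    ring
  have hmain : logRseqMain α n + 4 / n = (π * M - Real.log 8 - Real.log n - 1 / (π * M) -
      1 / (2 * π ^ 2 * M ^ 2) - 1 / (3 * π ^ 3 * M ^ 3) - α * Real.log n) / M ^ 2 := by
    rw [logRseqMain, hrpow (-1 / 2) 1 (by norm_num), hrpow (-1) 2 (by norm_num),
      hrpow (-3 / 2) 3 (by norm_num), hrpow (-2) 4 (by norm_num), hrpow (-5 / 2) 5 (by norm_num)]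
    generalize Real.log n = l
    rw [hnM]
    field_simp
    ring
  have hlogr : Real.log (rseq α n) = (Real.log (pbar n) - α * Real.log n) / M ^ 2 := by
    rw [rseq, Real.log_rpow (div_pos hpR hα0), Real.log_div hpR.ne' hα0.ne', Real.log_rpow hn0,
      ← hnM, inv_mul_eq_div]
  rw [hmain, hlogr, ← sub_div, abs_div, abs_of_pos (by positivity : 0 < M ^ 2),
    sub_sub_sub_cancel_right, div_le_iff₀ (by positivity)]
  refine hlog.trans_eq ?_
  rw [hnM]
  field_simp

theorem sq_rseq_lt {α Y : ℝ} {n : ℕ} (hα : 0 ≤ α) (hn : 5476 ≤ n) (hY : 8 ≤ Y)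
    (hYn : Y ^ 4 = n) (hαY : 2 * (α + 1) + Real.log 8 + 1 ≤ 3 * π / 4 * Y) :
    (rseq α (n + 1)) ^ 2 < rseq α n * rseq α (n + 2) := by
  obtain ⟨p0, e0⟩ := abs_log_rseq_sub_le (α := α) hn
  obtain ⟨p1, e1⟩ := abs_log_rseq_sub_le (α := α) (n := n + 1) (by omega)
  obtain ⟨p2, e2⟩ := abs_log_rseq_sub_le (α := α) (n := n + 2) (by omega)
  have hnR : (5476 : ℝ) ≤ n := by exact_mod_cast hn
  have hn0 : (0 : ℝ) < n := by linarith
  push_cast at e1 e2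
  have hconv := (convexOn_logRseqMain hα hY hαY).2 (x := (n : ℝ)) (y := (n : ℝ) + 2)
    (by rw [hYn]; exact Set.self_mem_Ici) (by rw [hYn, Set.mem_Ici]; linarith)
    (by norm_num : (0 : ℝ) ≤ 1 / 2) (by norm_num : (0 : ℝ) ≤ 1 / 2) (by norm_num)
  simp only [smul_eq_mul] at hconv
  rw [show (1 / 2 * (n : ℝ) + 1 / 2 * (n + 2)) = n + 1 by ring] at hconv
  have h1 : 1 / ((n : ℝ) + 1) ^ 3 ≤ 1 / (n : ℝ) ^ 3 := by gcongr; linarith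
  have h2 : 1 / ((n : ℝ) + 2) ^ 3 ≤ 1 / (n : ℝ) ^ 3 := by gcongr; linarith
  have h3 : 4 * (1 / (n : ℝ) ^ 3) < 4 / n + 4 / ((n : ℝ) + 2) - 2 * (4 / ((n : ℝ) + 1)) := by
    have : 4 / (n : ℝ) + 4 / ((n : ℝ) + 2) - 2 * (4 / ((n : ℝ) + 1)) =
        8 / (n * (n + 1) * (n + 2)) := by field_simp; ring
    rw [this, mul_one_div, div_lt_div_iff₀ (by positivity) (by positivity)]
    have h4 : (n : ℝ) * (n * 5476) ≤ n * (n * n) := by gcongr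
    nlinarith
  have hlog : Real.log (rseq α (n + 1) ^ 2) < Real.log (rseq α n * rseq α (n + 2)) := by
    rw [Real.log_pow, Real.log_mul p0.ne' p2.ne']
    push_cast
    linarith [(abs_le.mp e0).1, (abs_le.mp e1).2, (abs_le.mp e2).1]
  exact (Real.log_lt_log_iff (by positivity) (by positivity)).mp hlog

theorem stmt3 (α : ℝ) (hα : 0 ≤ α) (n : ℕ) (hn : Ncut 2 α ≤ (n : ℝ)) :
    (rseq α (n + 1)) ^ 2 < rseq α n * rseq α (n + 2) := by
  have hN₃ : N₃ 2 α ≤ n := ((le_max_right _ _).trans (le_max_right _ _)).trans hn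
  have h5505 : (5505 : ℝ) ≤ n :=
    ((le_max_left _ _).trans (le_max_left _ _)).trans hN₃
  have hC : (Crα 2 α / Cr 2) ^ 4 ≤ (n : ℝ) :=
    (Int.le_ceil _).trans (((le_max_right _ _).trans (le_max_right _ _)).trans hN₃)
  have hY4 : ((n : ℝ) ^ (1 / 4 : ℝ)) ^ 4 = n := by
    rw [← Real.rpow_natCast, ← Real.rpow_mul (by positivity)]
    norm_num
  have hY0 : 0 ≤ (n : ℝ) ^ (1 / 4 : ℝ) := by positivity
  have hCr : Cr 2 = 3 * π / 4 := by
    simp [Cr, ascPochhammer_succ_right]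
    ring
  have hCrα : Crα 2 α = 2 * (α + 1) + Real.log 8 + 1 := by
    simp [Crα]
    ring
  refine sq_rseq_lt (Y := (n : ℝ) ^ (1 / 4 : ℝ)) hα ?_ ?_ hY4 ?_
  · exact_mod_cast (by linarith : (5476 : ℝ) ≤ n)
  · exact le_of_pow_le_pow_left₀ four_ne_zero hY0 (by rw [hY4]; linarith)
  · have := le_of_pow_le_pow_left₀ four_ne_zero hY0 (hC.trans_eq hY4.symm)
    rwa [hCr, hCrα, div_le_iff₀' (by positivity)] at this
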